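/- Let (X₁,μ₁), (X₂,μ₂), (Y₁,ν₁), (Y₂,ν₂) be standard measure spaces, and let U ⊆ B(L²(X₁),L²(X₂)) and V ⊆ B(L²(Y₁),L²(Y₂)) be weak* closed masa-bimodules (with respect to the corresponding multiplication masas) with supports κ ⊆ X₁×X₂ and λ ⊆ Y₁×Y₂, respectively. Then: (a) supp F(U,V) = ρ(κ×λ), where ρ is the flip map; and (b) F(M_max(κ), M_max(λ)) = M_max(ρ(κ×λ)). -/

import Mathlib

open scoped ComplexInnerProductSpace Pointwise
open Set MeasureTheory

noncomputable section

namespace OpSynth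

/-! ### The σ-weak (weak*) topology on `B(H,K)` -/

/-- The σ-weak (weak*) topology on the space of bounded operators between Hilbert
spaces: the initial topology with respect to the functionals
`T ↦ ∑' n, ⟪η n, T (ξ n)⟫` associated to square-summable sequences `ξ`, `η`.
This is the weak* topology arising from the identification of `B(H,K)` with the
dual of the trace class operators. -/
def sigmaWeak (H K : Type*) [NormedAddCommGroup H] [InnerProductSpace ℂ H]
    [NormedAddCommGroup K] [InnerProductSpace ℂ K] :
    TopologicalSpace (H →L[ℂ] K) :=
  ⨅ (ξ : ℕ → H) (η : ℕ → K) (_ : Summable fun n => ‖ξ n‖ ^ 2)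
    (_ : Summable fun n => ‖η n‖ ^ 2),
    TopologicalSpace.induced
      (fun T : H →L[ℂ] K => ∑' n, ⟪η n, T (ξ n)⟫) inferInstance

section Basic

variable {H K H₁ H₂ H₃ K₁ K₂ T₁ T₂ : Type*}
  [NormedAddCommGroup H] [InnerProductSpace ℂ H]
  [NormedAddCommGroup K] [InnerProductSpace ℂ K]
  [NormedAddCommGroup H₁] [InnerProductSpace ℂ H₁]
  [NormedAddCommGroup H₂] [InnerProductSpace ℂ H₂]
  [NormedAddCommGroup H₃] [InnerProductSpace ℂ H₃]
  [NormedAddCommGroup K₁] [InnerProductSpace ℂ K₁]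
  [NormedAddCommGroup K₂] [InnerProductSpace ℂ K₂]
  [NormedAddCommGroup T₁] [InnerProductSpace ℂ T₁]
  [NormedAddCommGroup T₂] [InnerProductSpace ℂ T₂]

/-- A set of operators is weak* closed if it is closed in the σ-weak topology. -/
def WkClosed (S : Set (H →L[ℂ] K)) : Prop :=
  @IsClosed _ (sigmaWeak H K) S

/-- The weak* closure of a set of operators. -/
def wkClosure (S : Set (H →L[ℂ] K)) : Set (H →L[ℂ] K) :=
  @closure _ (sigmaWeak H K) S

/-- A weak* closed (linear) subspace of `B(H,K)`. -/
def IsWkClosedSubspace (S : Set (H →L[ℂ] K)) : Prop :=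
  (∃ M : Submodule ℂ (H →L[ℂ] K), (M : Set (H →L[ℂ] K)) = S) ∧ WkClosed S

/-- A map between operator spaces is weak* continuous if it is continuous with
respect to the σ-weak topologies. -/
def WkContinuous (φ : (H₁ →L[ℂ] H₂) → (K₁ →L[ℂ] K₂)) : Prop :=
  @Continuous _ _ (sigmaWeak H₁ H₂) (sigmaWeak K₁ K₂) φ

/-- The norm of an `n × n` matrix of operators, viewed as an operator on the
column Hilbert space `ℓ²(Fin n, H)`: the supremum over the unit ball of the
ℓ²-norm of the image. -/
def blockNorm {n : ℕ} (M : Matrix (Fin n) (Fin n) (H →L[ℂ] K)) : ℝ :=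
  sSup { r | ∃ v : Fin n → H, (∑ j, ‖v j‖ ^ 2) ≤ 1 ∧
    r = Real.sqrt (∑ i, ‖∑ j, M i j (v j)‖ ^ 2) }

/-- A map `φ : B(H₁,H₂) → B(K₁,K₂)` is completely bounded if its matrix
amplifications are uniformly bounded. -/
def CompletelyBounded (φ : (H₁ →L[ℂ] H₂) → (K₁ →L[ℂ] K₂)) : Prop :=
  ∃ C : ℝ, 0 ≤ C ∧ ∀ (n : ℕ) (M : Matrix (Fin n) (Fin n) (H₁ →L[ℂ] H₂)),
    blockNorm (M.map φ) ≤ C * blockNorm M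

/-- `t : H → K → T₁` realizes `T₁` as the Hilbertian tensor product `H ⊗ K`:
`t` is bilinear, multiplicative for inner products, and has total range. -/
def IsTensorEmbedding (t : H → K → T₁) : Prop :=
  (∀ x x' y, t (x + x') y = t x y + t x' y) ∧
  (∀ x y y', t x (y + y') = t x y + t x y') ∧
  (∀ (c : ℂ) x y, t (c • x) y = c • t x y) ∧
  (∀ (c : ℂ) x y, t x (c • y) = c • t x y) ∧
  (∀ x x' y y', ⟪t x y, t x' y'⟫ = ⟪x, x'⟫ * ⟪y, y'⟫) ∧
  (Submodule.span ℂ { z | ∃ x y, z = t x y }).topologicalClosure = ⊤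

/-- `W` is the elementary tensor `S ⊗ R` of the operators `S` and `R`, relative
to the tensor product realizations `t₁`, `t₂`. -/
def IsElemTensor (t₁ : H₁ → K₁ → T₁) (t₂ : H₂ → K₂ → T₂)
    (W : T₁ →L[ℂ] T₂) (S : H₁ →L[ℂ] H₂) (R : K₁ →L[ℂ] K₂) : Prop :=
  ∀ x y, W (t₁ x y) = t₂ (S x) (R y)

/-- The weak* closed tensor product `V ⊗̄ U`: the weak* closed subspace generated
by the elementary tensors `S ⊗ R` with `S ∈ V`, `R ∈ U`. -/
def wTensor (t₁ : H₁ → K₁ → T₁) (t₂ : H₂ → K₂ → T₂)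
    (V : Set (H₁ →L[ℂ] H₂)) (U : Set (K₁ →L[ℂ] K₂)) : Set (T₁ →L[ℂ] T₂) :=
  wkClosure ↑(Submodule.span ℂ
    { W : T₁ →L[ℂ] T₂ | ∃ S ∈ V, ∃ R ∈ U, IsElemTensor t₁ t₂ W S R })

/-- The Fubini product `F(V,U) = (V ⊗̄ B(K₁,K₂)) ∩ (B(H₁,H₂) ⊗̄ U)`. -/
def Fubini (t₁ : H₁ → K₁ → T₁) (t₂ : H₂ → K₂ → T₂)
    (V : Set (H₁ →L[ℂ] H₂)) (U : Set (K₁ →L[ℂ] K₂)) : Set (T₁ →L[ℂ] T₂) :=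
  wTensor t₁ t₂ V univ ∩ wTensor t₁ t₂ univ U

/-- Sum of finitely many subsets of an additive monoid. -/
def setSum {α : Type*} [AddCommMonoid α] {n : ℕ} (S : Fin n → Set α) : Set α :=
  { x | ∃ f : Fin n → α, (∀ i, f i ∈ S i) ∧ x = ∑ i, f i }

/-- The reflexive hull `Ref W = {T : Tx ∈ closure (W x) for all x}`. -/
def RefHull (W : Set (H →L[ℂ] K)) : Set (H →L[ℂ] K) :=
  { T | ∀ x : H, T x ∈ closure ((fun S : H →L[ℂ] K => S x) '' W) }

end Basic

/-- Property `S_σ`: `F(V,U) = V ⊗̄ U` for every weak* closed subspace `U` of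
`B(K₁,K₂)`, all Hilbert spaces `K₁`, `K₂`, and all realizations of the
corresponding Hilbertian tensor products. -/
def HasSsigma {H₁ H₂ : Type*}
    [NormedAddCommGroup H₁] [InnerProductSpace ℂ H₁]
    [NormedAddCommGroup H₂] [InnerProductSpace ℂ H₂]
    (V : Set (H₁ →L[ℂ] H₂)) : Prop :=
  ∀ (K₁ K₂ T₁ T₂ : Type)
    [NormedAddCommGroup K₁] [InnerProductSpace ℂ K₁] [CompleteSpace K₁]
    [NormedAddCommGroup K₂] [InnerProductSpace ℂ K₂] [CompleteSpace K₂]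
    [NormedAddCommGroup T₁] [InnerProductSpace ℂ T₁] [CompleteSpace T₁]
    [NormedAddCommGroup T₂] [InnerProductSpace ℂ T₂] [CompleteSpace T₂]
    (t₁ : H₁ → K₁ → T₁) (t₂ : H₂ → K₂ → T₂),
    IsTensorEmbedding t₁ → IsTensorEmbedding t₂ →
    ∀ U : Set (K₁ →L[ℂ] K₂), IsWkClosedSubspace U →
      Fubini t₁ t₂ V U = wTensor t₁ t₂ V U

section Masa

variable {H H₁ H₂ H₃ : Type*}
  [NormedAddCommGroup H] [InnerProductSpace ℂ H] [CompleteSpace H]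
  [NormedAddCommGroup H₁] [InnerProductSpace ℂ H₁] [CompleteSpace H₁]
  [NormedAddCommGroup H₂] [InnerProductSpace ℂ H₂] [CompleteSpace H₂]
  [NormedAddCommGroup H₃] [InnerProductSpace ℂ H₃] [CompleteSpace H₃]

/-- A masa: a maximal abelian selfadjoint subalgebra of `B(H)`. -/
def IsMasa (D : StarSubalgebra ℂ (H →L[ℂ] H)) : Prop :=
  (∀ a ∈ D, ∀ b ∈ D, a * b = b * a) ∧
  ∀ E : StarSubalgebra ℂ (H →L[ℂ] H),
    (∀ a ∈ E, ∀ b ∈ E, a * b = b * a) → D ≤ E → E = D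

/-- A (weak* closed) `D₂,D₁`-masa-bimodule. -/
def IsMasaBimodule (D₁ : StarSubalgebra ℂ (H₁ →L[ℂ] H₁))
    (D₂ : StarSubalgebra ℂ (H₂ →L[ℂ] H₂)) (V : Set (H₁ →L[ℂ] H₂)) : Prop :=
  IsWkClosedSubspace V ∧
  ∀ X ∈ V, ∀ A ∈ D₁, ∀ B ∈ D₂, B ∘L X ∘L A ∈ V

/-- A ternary set of operators: closed under the triple product `T S* R`. -/
def IsTernary (M : Set (H₁ →L[ℂ] H₂)) : Prop :=
  ∀ T ∈ M, ∀ S ∈ M, ∀ R ∈ M, T ∘L (ContinuousLinearMap.adjoint S) ∘L R ∈ M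

/-- An orthogonal projection. -/
def IsProj (p : H →L[ℂ] H) : Prop := p ∘L p = p ∧ IsSelfAdjoint p

/-- A minimal non-zero projection of a masa. -/
def IsMinimalProjOf (D : StarSubalgebra ℂ (H →L[ℂ] H)) (p : H →L[ℂ] H) : Prop :=
  p ∈ D ∧ IsProj p ∧ p ≠ 0 ∧
    ∀ q ∈ D, IsProj q → p ∘L q = q → q = 0 ∨ q = p

/-- A projection in a masa is non-atomic if it dominates no minimal non-zero
projection of the masa. -/
def IsNonAtomicProj (D : StarSubalgebra ℂ (H →L[ℂ] H)) (E : H →L[ℂ] H) : Prop :=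
  ∀ p, IsMinimalProjOf D p → ¬ (E ∘L p = p)

/-- A `D₂,D₁`-masa-bimodule map. -/
def IsMasaBimoduleMap (D₁ : StarSubalgebra ℂ (H₁ →L[ℂ] H₁))
    (D₂ : StarSubalgebra ℂ (H₂ →L[ℂ] H₂))
    (φ : (H₁ →L[ℂ] H₂) → (H₁ →L[ℂ] H₂)) : Prop :=
  ∀ (X : H₁ →L[ℂ] H₂), ∀ A ∈ D₁, ∀ B ∈ D₂,
    φ (B ∘L X ∘L A) = B ∘L (φ X) ∘L A

/-- A Schur idempotent: a weak* continuous completely bounded idempotent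
masa-bimodule map. -/
def IsSchurIdempotent (D₁ : StarSubalgebra ℂ (H₁ →L[ℂ] H₁))
    (D₂ : StarSubalgebra ℂ (H₂ →L[ℂ] H₂))
    (φ : (H₁ →L[ℂ] H₂) → (H₁ →L[ℂ] H₂)) : Prop :=
  IsLinearMap ℂ φ ∧ WkContinuous φ ∧ CompletelyBounded φ ∧ φ ∘ φ = φ ∧
    IsMasaBimoduleMap D₁ D₂ φ

/-- A nest: a totally ordered family of closed subspaces containing the
intersection and the closed linear span of any of its subsets. -/
def IsNest (N : Set (Submodule ℂ H)) : Prop :=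
  (∀ p ∈ N, IsClosed (p : Set H)) ∧ IsChain (· ≤ ·) N ∧
  ∀ S : Set (Submodule ℂ H), S ⊆ N →
    sInf S ∈ N ∧ (sSup S).topologicalClosure ∈ N

/-- The nest algebra of a nest: all operators leaving each subspace invariant. -/
def nestAlg (N : Set (Submodule ℂ H)) : Set (H →L[ℂ] H) :=
  { T | ∀ p ∈ N, ∀ x ∈ p, T x ∈ p }

/-- A (weak* closed) nest algebra bimodule. -/
def IsNestBimodule (V : Set (H₁ →L[ℂ] H₂)) : Prop :=
  IsWkClosedSubspace V ∧
  ∃ (N₁ : Set (Submodule ℂ H₁)) (N₂ : Set (Submodule ℂ H₂)),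
    IsNest N₁ ∧ IsNest N₂ ∧
    ∀ X ∈ V, ∀ A ∈ nestAlg N₁, ∀ B ∈ nestAlg N₂, B ∘L X ∘L A ∈ V

/-- A masa-bimodule of finite width: a finite intersection of masa-bimodules
each of which is a nest algebra bimodule. -/
def HasFiniteWidth (D₁ : StarSubalgebra ℂ (H₁ →L[ℂ] H₁))
    (D₂ : StarSubalgebra ℂ (H₂ →L[ℂ] H₂)) (V : Set (H₁ →L[ℂ] H₂)) : Prop :=
  ∃ (k : ℕ) (Vs : Fin k → Set (H₁ →L[ℂ] H₂)),
    (∀ j, IsMasaBimodule D₁ D₂ (Vs j) ∧ IsNestBimodule (Vs j)) ∧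
    V = ⋂ j, Vs j

end Masa

section Algebras

variable {H H₁ H₂ H₃ K : Type*}
  [NormedAddCommGroup H] [InnerProductSpace ℂ H] [CompleteSpace H]
  [NormedAddCommGroup H₁] [InnerProductSpace ℂ H₁] [CompleteSpace H₁]
  [NormedAddCommGroup H₂] [InnerProductSpace ℂ H₂] [CompleteSpace H₂]
  [NormedAddCommGroup H₃] [InnerProductSpace ℂ H₃] [CompleteSpace H₃]

/-- A weak* closed unital operator algebra in `B(H)`. -/
def IsWkClosedUnitalAlg (A : Set (H →L[ℂ] H)) : Prop :=
  IsWkClosedSubspace A ∧ (1 : H →L[ℂ] H) ∈ A ∧ ∀ a ∈ A, ∀ b ∈ A, a ∘L b ∈ A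

/-- `[X Y]`: the weak* closed linear span of the products `x ∘ y`. -/
def mulSpan (X : Set (H₂ →L[ℂ] H₃)) (Y : Set (H₁ →L[ℂ] H₂)) :
    Set (H₁ →L[ℂ] H₃) :=
  wkClosure ↑(Submodule.span ℂ { T : H₁ →L[ℂ] H₃ | ∃ x ∈ X, ∃ y ∈ Y, T = x ∘L y })

/-- The data witnessing a spatial embedding of `A` into `B`. -/
def SpatialPair (A : Set (H₁ →L[ℂ] H₁)) (B : Set (H₂ →L[ℂ] H₂))
    (X : Set (H₁ →L[ℂ] H₂)) (Y : Set (H₂ →L[ℂ] H₁)) : Prop :=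
  IsWkClosedSubspace X ∧ IsWkClosedSubspace Y ∧
  (∀ x ∈ X, ∀ b ∈ B, ∀ a ∈ A, b ∘L x ∘L a ∈ X) ∧
  (∀ y ∈ Y, ∀ a ∈ A, ∀ b ∈ B, a ∘L y ∘L b ∈ Y) ∧
  mulSpan X Y ⊆ B ∧ mulSpan Y X = A

/-- `A` is spatially embedded in `B`. -/
def SpatiallyEmbedded (A : Set (H₁ →L[ℂ] H₁)) (B : Set (H₂ →L[ℂ] H₂)) : Prop :=
  ∃ X Y, SpatialPair A B X Y

/-- `A` and `B` are spatially Morita equivalent. -/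
def SpatiallyMorita (A : Set (H₁ →L[ℂ] H₁)) (B : Set (H₂ →L[ℂ] H₂)) : Prop :=
  ∃ X Y, SpatialPair A B X Y ∧ mulSpan X Y = B

/-- The strong operator topology on `B(H,K)`. -/
def sot (H K : Type*) [NormedAddCommGroup H] [InnerProductSpace ℂ H]
    [NormedAddCommGroup K] [InnerProductSpace ℂ K] :
    TopologicalSpace (H →L[ℂ] K) :=
  TopologicalSpace.induced (fun T : H →L[ℂ] K => (T : H → K)) Pi.topologicalSpace

/-- A commutative subspace lattice (CSL): a strongly closed lattice of mutually
commuting orthogonal projections containing `0` and `1`. -/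
def IsCSL (L : Set (H →L[ℂ] H)) : Prop :=
  (∀ P ∈ L, IsProj P) ∧
  (∀ P ∈ L, ∀ Q ∈ L, P ∘L Q = Q ∘L P) ∧
  (0 : H →L[ℂ] H) ∈ L ∧ (1 : H →L[ℂ] H) ∈ L ∧
  (∀ P ∈ L, ∀ Q ∈ L, P ∘L Q ∈ L ∧ P + Q - P ∘L Q ∈ L) ∧
  @IsClosed _ (sot H H) L

/-- The CSL algebra `Alg L = {T : (1 - P) T P = 0 for all P ∈ L}`. -/
def cslAlg (L : Set (H →L[ℂ] H)) : Set (H →L[ℂ] H) :=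
  { T | ∀ P ∈ L, (1 - P) ∘L T ∘L P = 0 }

/-- A lattice homomorphism between CSLs (preserving meets and joins). -/
def IsLatticeHom (L₁ : Set (H₁ →L[ℂ] H₁)) (L₂ : Set (H₂ →L[ℂ] H₂))
    (φ : (H₁ →L[ℂ] H₁) → (H₂ →L[ℂ] H₂)) : Prop :=
  MapsTo φ L₁ L₂ ∧
  (∀ P ∈ L₁, ∀ Q ∈ L₁, φ (P ∘L Q) = φ P ∘L φ Q) ∧
  (∀ P ∈ L₁, ∀ Q ∈ L₁, φ (P + Q - P ∘L Q) = φ P + φ Q - φ P ∘L φ Q)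

end Algebras

section MeasurePart

variable {X X₁ X₂ : Type*} [MeasurableSpace X] [MeasurableSpace X₁] [MeasurableSpace X₂]

/-- A subset of a product of measure spaces is marginally null if it is
contained in `(M₁ × X₂) ∪ (X₁ × M₂)` with `μ₁ M₁ = μ₂ M₂ = 0`. -/
def MargNull (μ₁ : Measure X₁) (μ₂ : Measure X₂) (E : Set (X₁ × X₂)) : Prop :=
  ∃ (M₁ : Set X₁) (M₂ : Set X₂), MeasurableSet M₁ ∧ MeasurableSet M₂ ∧
    μ₁ M₁ = 0 ∧ μ₂ M₂ = 0 ∧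
    E ⊆ (M₁ ×ˢ (univ : Set X₂)) ∪ ((univ : Set X₁) ×ˢ M₂)

/-- Marginal equivalence: the symmetric difference is marginally null. -/
def MargEquiv (μ₁ : Measure X₁) (μ₂ : Measure X₂) (E F : Set (X₁ × X₂)) : Prop :=
  MargNull μ₁ μ₂ ((E \ F) ∪ (F \ E))

/-- ω-open sets: marginally equivalent to a countable union of measurable
rectangles. -/
def OmegaOpen (μ₁ : Measure X₁) (μ₂ : Measure X₂) (E : Set (X₁ × X₂)) : Prop :=
  ∃ (α : ℕ → Set X₁) (β : ℕ → Set X₂),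
    (∀ n, MeasurableSet (α n)) ∧ (∀ n, MeasurableSet (β n)) ∧
    MargEquiv μ₁ μ₂ E (⋃ n, (α n) ×ˢ (β n))

/-- ω-closed sets: complements of ω-open sets. -/
def OmegaClosed (μ₁ : Measure X₁) (μ₂ : Measure X₂) (E : Set (X₁ × X₂)) : Prop :=
  OmegaOpen μ₁ μ₂ Eᶜ

/-- `A` is a multiplication operator on `L²(X,μ)`: `A f = φ · f` for some
essentially bounded function `φ`.  The collection `{A | IsMultOp μ A}` is the
multiplication masa of `L^∞(X,μ)`. -/
def IsMultOp (μ : Measure X) (A : Lp ℂ 2 μ →L[ℂ] Lp ℂ 2 μ) : Prop :=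
  ∃ φ : X → ℂ, AEStronglyMeasurable φ μ ∧ (∃ C, ∀ᵐ x ∂μ, ‖φ x‖ ≤ C) ∧
    ∀ f : Lp ℂ 2 μ, ⇑(A f) =ᵐ[μ] fun x => φ x * f x

/-- A (weak* closed) masa-bimodule over the multiplication masas. -/
def IsMultBimodule (μ₁ : Measure X₁) (μ₂ : Measure X₂)
    (V : Set (Lp ℂ 2 μ₁ →L[ℂ] Lp ℂ 2 μ₂)) : Prop :=
  IsWkClosedSubspace V ∧
  ∀ X ∈ V, ∀ (A : Lp ℂ 2 μ₁ →L[ℂ] Lp ℂ 2 μ₁) (B : Lp ℂ 2 μ₂ →L[ℂ] Lp ℂ 2 μ₂),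
    IsMultOp μ₁ A → IsMultOp μ₂ B → B ∘L X ∘L A ∈ V

/-- `T` is supported on `κ`: `M_{χ_β} T M_{χ_α} = 0` (equivalently,
`⟪T f, g⟫ = 0` whenever `f` vanishes off `α` and `g` vanishes off `β`)
whenever the rectangle `α × β` intersects `κ` marginally nullly. -/
def SupportedOn (μ₁ : Measure X₁) (μ₂ : Measure X₂) (κ : Set (X₁ × X₂))
    (T : Lp ℂ 2 μ₁ →L[ℂ] Lp ℂ 2 μ₂) : Prop :=
  ∀ (α : Set X₁) (β : Set X₂), MeasurableSet α → MeasurableSet β →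
    MargNull μ₁ μ₂ ((α ×ˢ β) ∩ κ) →
    ∀ (f : Lp ℂ 2 μ₁) (g : Lp ℂ 2 μ₂),
      (∀ᵐ x ∂μ₁, x ∉ α → f x = 0) → (∀ᵐ y ∂μ₂, y ∉ β → g y = 0) →
      ⟪T f, g⟫ = (0 : ℂ)

/-- `M_max κ`: the space of all operators supported on `κ` — the largest
masa-bimodule with support `κ`. -/
def Mmax (μ₁ : Measure X₁) (μ₂ : Measure X₂) (κ : Set (X₁ × X₂)) :
    Set (Lp ℂ 2 μ₁ →L[ℂ] Lp ℂ 2 μ₂) :=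
  { T | SupportedOn μ₁ μ₂ κ T }

/-- `U` has support `κ`: `κ` is ω-closed and `Ref U = M_max κ`. -/
def HasSupport (μ₁ : Measure X₁) (μ₂ : Measure X₂)
    (U : Set (Lp ℂ 2 μ₁ →L[ℂ] Lp ℂ 2 μ₂)) (κ : Set (X₁ × X₂)) : Prop :=
  OmegaClosed μ₁ μ₂ κ ∧ RefHull U = Mmax μ₁ μ₂ κ

/-- `M_min κ`: the smallest weak* closed masa-bimodule with support `κ`,
realized as the intersection of all weak* closed masa-bimodules with support `κ`. -/
def Mmin (μ₁ : Measure X₁) (μ₂ : Measure X₂) (κ : Set (X₁ × X₂)) :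
    Set (Lp ℂ 2 μ₁ →L[ℂ] Lp ℂ 2 μ₂) :=
  ⋂₀ { U | IsMultBimodule μ₁ μ₂ U ∧ HasSupport μ₁ μ₂ U κ }

/-- `κ` is operator synthetic if it is ω-closed and `M_min κ = M_max κ`. -/
def OperatorSynthetic (μ₁ : Measure X₁) (μ₂ : Measure X₂)
    (κ : Set (X₁ × X₂)) : Prop :=
  OmegaClosed μ₁ μ₂ κ ∧ Mmin μ₁ μ₂ κ = Mmax μ₁ μ₂ κ

/-- A masa-bimodule of finite width over the multiplication masas. -/
def MultFiniteWidth (μ₁ : Measure X₁) (μ₂ : Measure X₂)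
    (V : Set (Lp ℂ 2 μ₁ →L[ℂ] Lp ℂ 2 μ₂)) : Prop :=
  ∃ (k : ℕ) (Vs : Fin k → Set (Lp ℂ 2 μ₁ →L[ℂ] Lp ℂ 2 μ₂)),
    (∀ j, IsMultBimodule μ₁ μ₂ (Vs j) ∧ IsNestBimodule (Vs j)) ∧
    V = ⋂ j, Vs j

/-- A set of finite width: the support of a masa-bimodule of finite width. -/
def FiniteWidthSet (μ₁ : Measure X₁) (μ₂ : Measure X₂)
    (κ : Set (X₁ × X₂)) : Prop :=
  ∃ V, MultFiniteWidth μ₁ μ₂ V ∧ HasSupport μ₁ μ₂ V κ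

end MeasurePart

/-- The flip `ρ : (X₁ × X₂) × (Y₁ × Y₂) → (X₁ × Y₁) × (X₂ × Y₂)`. -/
def flipProd {X₁ X₂ Y₁ Y₂ : Type*} :
    (X₁ × X₂) × (Y₁ × Y₂) → (X₁ × Y₁) × (X₂ × Y₂) :=
  fun q => ((q.1.1, q.2.1), (q.1.2, q.2.2))

end OpSynth



open scoped ComplexInnerProductSpace Pointwise
open Set MeasureTheory OpSynth


namespace OpSynth
open Filter Topology

section Abs
variable {H K : Type*}
  [NormedAddCommGroup H] [InnerProductSpace ℂ H]
  [NormedAddCommGroup K] [InnerProductSpace ℂ K]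

theorem cs_aux {J : Type*} {a b : J → ℝ} (ha : ∀ n, 0 ≤ a n) (hb : ∀ n, 0 ≤ b n)
    (hsa : Summable fun n => a n ^ 2) (hsb : Summable fun n => b n ^ 2) :
    Summable (fun n => a n * b n) ∧
      ∑' n, a n * b n ≤ √(∑' n, a n ^ 2) * √(∑' n, b n ^ 2) := by
  have := Real.inner_le_Lp_mul_Lq_tsum_of_nonneg (p := 2) (q := 2)
    (by constructor <;> norm_num) ha hb (by simpa using hsa) (by simpa using hsb)
  refine ⟨Summable.of_nonneg_of_le (fun n => mul_nonneg (ha n) (hb n)) (fun n => ?_)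
    (hsa.add hsb), ?_⟩
  · nlinarith [sq_nonneg (a n - b n), ha n, hb n, mul_nonneg (ha n) (hb n)]
  · simpa [Real.sqrt_eq_rpow] using this

theorem cs_op {J : Type*} {ξ : J → H} {η : J → K} (hξ : Summable fun n => ‖ξ n‖ ^ 2)
    (hη : Summable fun n => ‖η n‖ ^ 2) (T : H →L[ℂ] K) :
    Summable (fun n => ‖⟪η n, T (ξ n)⟫‖) ∧
      ‖∑' n, ⟪η n, T (ξ n)⟫‖ ≤ ‖T‖ * (√(∑' n, ‖ξ n‖ ^ 2) * √(∑' n, ‖η n‖ ^ 2)) := by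
  obtain ⟨h1, h2⟩ := cs_aux (fun n => norm_nonneg (ξ n)) (fun n => norm_nonneg (η n)) hξ hη
  have hb : ∀ n, ‖⟪η n, T (ξ n)⟫‖ ≤ ‖T‖ * (‖ξ n‖ * ‖η n‖) := fun n => by
    calc ‖⟪η n, T (ξ n)⟫‖ ≤ ‖η n‖ * ‖T (ξ n)‖ := norm_inner_le_norm _ _
      _ ≤ ‖η n‖ * (‖T‖ * ‖ξ n‖) := by gcongr; exact T.le_opNorm _
      _ = _ := by ring
  have hs := Summable.of_nonneg_of_le (fun n => norm_nonneg _) hb (h1.mul_left ‖T‖)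
  refine ⟨hs, (norm_tsum_le_tsum_norm hs).trans ?_⟩
  refine (hs.tsum_le_tsum hb (h1.mul_left ‖T‖)).trans ?_
  rw [tsum_mul_left]
  gcongr

theorem cs_summable {J : Type*} {ξ : J → H} {η : J → K} (hξ : Summable fun n => ‖ξ n‖ ^ 2)
    (hη : Summable fun n => ‖η n‖ ^ 2) (T : H →L[ℂ] K) :
    Summable (fun n => ⟪η n, T (ξ n)⟫) := (cs_op hξ hη T).1.of_norm

theorem tendsto_sw {ι : Type*} {l : Filter ι} {f : ι → H →L[ℂ] K} {T : H →L[ℂ] K} :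
    Tendsto f l (@nhds _ (sigmaWeak H K) T) ↔
      ∀ (ξ : ℕ → H) (η : ℕ → K), (Summable fun n => ‖ξ n‖ ^ 2) → (Summable fun n => ‖η n‖ ^ 2) →
        Tendsto (fun i => ∑' n, ⟪η n, f i (ξ n)⟫) l (𝓝 (∑' n, ⟪η n, T (ξ n)⟫)) := by
  unfold sigmaWeak
  simp only [nhds_iInf, nhds_induced, tendsto_iInf, tendsto_comap_iff]
  rfl

theorem tendsto_sw_of_bdd {ι : Type*} {l : Filter ι} {f : ι → H →L[ℂ] K} {T : H →L[ℂ] K}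
    (C : ℝ) (hC : ∀ i, ‖f i‖ ≤ C)
    (h : ∀ x y, Tendsto (fun i => ⟪y, f i x⟫) l (𝓝 ⟪y, T x⟫)) :
    Tendsto f l (@nhds _ (sigmaWeak H K) T) := by
  rw [tendsto_sw]
  intro ξ η hξ hη
  obtain ⟨h1, -⟩ := cs_aux (fun n => norm_nonneg (ξ n)) (fun n => norm_nonneg (η n)) hξ hη
  refine tendsto_tsum_of_dominated_convergence (h1.mul_left C) (fun n => h _ _) ?_
  refine Eventually.of_forall fun i n => ?_
  calc ‖⟪η n, f i (ξ n)⟫‖ ≤ ‖η n‖ * ‖f i (ξ n)‖ := norm_inner_le_norm _ _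
      _ ≤ ‖η n‖ * (C * ‖ξ n‖) := by
        gcongr; exact ((f i).le_opNorm _).trans (by gcongr; exact hC i)
      _ = _ := by ring

/-- nuclear functionals -/
def Nuc (φ : (H →L[ℂ] K) → ℂ) (r : ℝ) : Prop :=
  ∃ (ξ : ℕ → H) (η : ℕ → K), (Summable fun n => ‖ξ n‖ ^ 2) ∧ (Summable fun n => ‖η n‖ ^ 2) ∧
    ∑' n, ‖ξ n‖ ^ 2 ≤ r ∧ ∑' n, ‖η n‖ ^ 2 ≤ r ∧ ∀ T, φ T = ∑' n, ⟪η n, T (ξ n)⟫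

theorem Nuc.nonneg {φ : (H →L[ℂ] K) → ℂ} {r : ℝ} (h : Nuc φ r) : 0 ≤ r := by
  obtain ⟨ξ, η, _, _, h, -⟩ := h
  exact (tsum_nonneg fun n => by positivity).trans h

theorem extend_normsq {J E : Type*} [NormedAddCommGroup E] {e : J → ℕ}
    (he : Function.Injective e) (u : J → E) :
    (fun n => ‖Function.extend e u 0 n‖ ^ 2) = Function.extend e (fun j => ‖u j‖ ^ 2) 0 := by
  funext n
  by_cases hn : ∃ j, e j = n
  · obtain ⟨j, rfl⟩ := hn
    simp [he.extend_apply]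
  · simp [Function.extend_apply' _ _ _ hn]

theorem nuc_of_countable {J : Type*} [Countable J] {ξ : J → H} {η : J → K} {r : ℝ}
    (hξ : Summable fun n => ‖ξ n‖ ^ 2) (hη : Summable fun n => ‖η n‖ ^ 2)
    (h1 : ∑' n, ‖ξ n‖ ^ 2 ≤ r) (h2 : ∑' n, ‖η n‖ ^ 2 ≤ r) :
    Nuc (fun T : H →L[ℂ] K => ∑' n, ⟪η n, T (ξ n)⟫) r := by
  obtain ⟨e, he⟩ := exists_injective_nat J
  refine ⟨Function.extend e ξ 0, Function.extend e η 0, ?_, ?_, ?_, ?_, ?_⟩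
  · rw [extend_normsq he]; exact (summable_extend_zero he).2 hξ
  · rw [extend_normsq he]; exact (summable_extend_zero he).2 hη
  · rw [extend_normsq he]; rwa [tsum_extend_zero he]
  · rw [extend_normsq he]; rwa [tsum_extend_zero he]
  · intro T
    show ∑' n, ⟪η n, T (ξ n)⟫ = _
    rw [← tsum_extend_zero he]
    congr 1
    funext n
    by_cases hn : ∃ j, e j = n
    · obtain ⟨j, rfl⟩ := hn
      simp [he.extend_apply]
    · simp [Function.extend_apply' _ _ _ hn]

theorem Nuc.mono {φ : (H →L[ℂ] K) → ℂ} {r s : ℝ} (h : Nuc φ r) (hrs : r ≤ s) : Nuc φ s := by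
  obtain ⟨ξ, η, a, b, c, d, e⟩ := h
  exact ⟨ξ, η, a, b, c.trans hrs, d.trans hrs, e⟩

theorem Nuc.add {φ ψ : (H →L[ℂ] K) → ℂ} {r s : ℝ} (h : Nuc φ r) (h' : Nuc ψ s) :
    Nuc (φ + ψ) (r + s) := by
  obtain ⟨ξ, η, a, b, c, d, e⟩ := h
  obtain ⟨ξ', η', a', b', c', d', e'⟩ := h'
  have H1 : HasSum (fun n => ‖Sum.elim ξ ξ' n‖ ^ 2) (∑' n, ‖ξ n‖ ^ 2 + ∑' n, ‖ξ' n‖ ^ 2) :=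
    HasSum.sum (by simpa [Function.comp_def] using a.hasSum) (by simpa [Function.comp_def] using a'.hasSum)
  have H2 : HasSum (fun n => ‖Sum.elim η η' n‖ ^ 2) (∑' n, ‖η n‖ ^ 2 + ∑' n, ‖η' n‖ ^ 2) :=
    HasSum.sum (by simpa [Function.comp_def] using b.hasSum) (by simpa [Function.comp_def] using b'.hasSum)
  have := nuc_of_countable H1.summable H2.summable (r := r + s) (by rw [H1.tsum_eq]; gcongr)
    (by rw [H2.tsum_eq]; gcongr)
  convert this using 1
  funext T
  rw [Pi.add_apply, e, e']
  symm
  apply HasSum.tsum_eq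
  exact HasSum.sum (by simpa [Function.comp_def] using (cs_summable a b T).hasSum)
    (by simpa [Function.comp_def] using (cs_summable a' b' T).hasSum)

theorem Nuc.smul {φ : (H →L[ℂ] K) → ℂ} {r : ℝ} (h : Nuc φ r) (c : ℂ) :
    Nuc (c • φ) (‖c‖ * r) := by
  obtain ⟨ξ, η, a, b, h1, h2, e⟩ := h
  by_cases hc : c = 0
  · subst hc
    exact ⟨0, 0, by simp [summable_zero], by simp [summable_zero], by simp, by simp, by simp⟩
  have hc' : 0 < ‖c‖ := norm_pos_iff.2 hc
  set s : ℝ := √‖c‖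
  have hs : s ^ 2 = ‖c‖ := Real.sq_sqrt hc'.le
  have hs0 : 0 < s := Real.sqrt_pos.2 hc'
  have n1 : ∀ n, ‖(c / s) • ξ n‖ ^ 2 = ‖c‖ * ‖ξ n‖ ^ 2 := fun n => by
    rw [norm_smul, mul_pow, norm_div, div_pow]
    have : ‖(s : ℂ)‖ ^ 2 = ‖c‖ := by
      rw [Complex.norm_real, Real.norm_of_nonneg hs0.le, hs]
    rw [this]; field_simp
  have n2 : ∀ n, ‖(s : ℂ) • η n‖ ^ 2 = ‖c‖ * ‖η n‖ ^ 2 := fun n => by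
    rw [norm_smul, mul_pow]
    rw [Complex.norm_real, Real.norm_of_nonneg hs0.le, hs]
  refine ⟨fun n => (c / s) • ξ n, fun n => (s : ℂ) • η n, ?_, ?_, ?_, ?_, ?_⟩
  · simp_rw [n1]; exact a.mul_left _
  · simp_rw [n2]; exact b.mul_left _
  · simp_rw [n1, tsum_mul_left]; gcongr
  · simp_rw [n2, tsum_mul_left]; gcongr
  · intro T
    rw [Pi.smul_apply, e, smul_eq_mul, ← tsum_mul_left]
    congr 1; funext n
    have : (s : ℂ) ≠ 0 := by exact_mod_cast hs0.ne'
    rw [map_smul, inner_smul_left, inner_smul_right, Complex.conj_ofReal]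
    field_simp

/-- the predual as a space of functions -/
def Pre (H K : Type*) [NormedAddCommGroup H] [InnerProductSpace ℂ H]
    [NormedAddCommGroup K] [InnerProductSpace ℂ K] : Submodule ℂ ((H →L[ℂ] K) → ℂ) where
  carrier := {φ | ∃ r, Nuc φ r}
  add_mem' := by
    rintro _ _ ⟨r, h⟩ ⟨s, h'⟩
    exact ⟨_, h.add h'⟩
  zero_mem' := ⟨0, 0, 0, by simp [summable_zero], by simp [summable_zero], by simp, by simp, by simp⟩
  smul_mem' := by
    rintro c _ ⟨r, h⟩
    exact ⟨_, h.smul c⟩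

theorem mem_pre_of {ξ : ℕ → H} {η : ℕ → K} (hξ : Summable fun n => ‖ξ n‖ ^ 2)
    (hη : Summable fun n => ‖η n‖ ^ 2) :
    (fun T : H →L[ℂ] K => ∑' n, ⟪η n, T (ξ n)⟫) ∈ Pre H K :=
  ⟨max (∑' n, ‖ξ n‖ ^ 2) (∑' n, ‖η n‖ ^ 2), ξ, η, hξ, hη, le_max_left _ _, le_max_right _ _,
    fun _ => rfl⟩

theorem pre_continuous {φ : (H →L[ℂ] K) → ℂ} (h : φ ∈ Pre H K) :
    @Continuous _ _ (sigmaWeak H K) _ φ := by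
  obtain ⟨r, ξ, η, hξ, hη, -, -, e⟩ := h
  obtain rfl : φ = _ := funext e
  let := sigmaWeak H K
  rw [continuous_iff_continuousAt]
  intro T
  exact (tendsto_sw (f := id) (l := 𝓝 T)).1 tendsto_id ξ η hξ hη

theorem pre_isLinear {φ : (H →L[ℂ] K) → ℂ} (h : φ ∈ Pre H K) : IsLinearMap ℂ φ := by
  obtain ⟨r, ξ, η, hξ, hη, -, -, e⟩ := h
  constructor
  · intro S T
    simp only [e, add_apply, inner_add_right]
    exact (cs_summable hξ hη S).tsum_add (cs_summable hξ hη T)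
  · intro c T
    simp only [e, smul_apply, inner_smul_right, smul_eq_mul]
    rw [tsum_mul_left]

/-- biannihilator theorem for the weak* closure -/
theorem mem_wkClosure_iff (M : Submodule ℂ (H →L[ℂ] K)) (T : H →L[ℂ] K) :
    T ∈ wkClosure (M : Set (H →L[ℂ] K)) ↔
      ∀ φ ∈ Pre H K, (∀ S ∈ M, φ S = 0) → φ T = 0 := by
  constructor
  · intro hT φ hφ h0
    let := sigmaWeak H K
    have hc : IsClosed {S | φ S = 0} := isClosed_eq (pre_continuous hφ) continuous_const
    exact closure_minimal (s := (M : Set (H →L[ℂ] K))) (fun S hS => h0 S hS) hc hT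
  · intro h
    have key : ∀ s : Finset (Pre H K), ∃ S ∈ M, ∀ φ ∈ s, φ.1 S = φ.1 T := by
      intro s
      classical
      let L : (H →L[ℂ] K) →ₗ[ℂ] (s → ℂ) :=
        LinearMap.pi fun φ => (pre_isLinear φ.1.2).mk' _
      by_cases hm : L T ∈ M.map L
      · obtain ⟨S, hS, hST⟩ := hm
        exact ⟨S, hS, fun φ hφ => congrFun hST ⟨φ, hφ⟩⟩
      · exfalso
        obtain ⟨c, hc1, hc2⟩ := Submodule.exists_le_ker_of_notMem hm
        let ψ : (H →L[ℂ] K) → ℂ := ∑ φ : s, (c (Pi.single φ 1)) • φ.1.1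
        have hψ : ∀ S, ψ S = c (L S) := by
          intro S
          conv_rhs => rw [← Finset.univ_sum_single (L S)]
          rw [map_sum]
          simp only [ψ, Finset.sum_apply, Pi.smul_apply, smul_eq_mul]
          refine Finset.sum_congr rfl fun φ _ => ?_
          have : (Pi.single φ (L S φ) : s → ℂ) = (L S φ) • Pi.single φ (1 : ℂ) := by
            rw [← Pi.single_smul]; simp
          rw [this, map_smul, smul_eq_mul, mul_comm]
          rfl
        refine hc1 ?_
        rw [← hψ]
        refine h ψ (Submodule.sum_mem _ fun φ _ => Submodule.smul_mem _ _ φ.1.2) ?_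
        intro S hS
        rw [hψ]
        exact hc2 ⟨S, hS, rfl⟩
    choose S hSM hS using key
    let := sigmaWeak H K
    refine mem_closure_of_tendsto (f := S) (b := atTop) ?_ (Eventually.of_forall hSM)
    rw [tendsto_sw]
    intro ξ η hξ hη
    refine tendsto_const_nhds.congr' ?_
    filter_upwards [eventually_ge_atTop {⟨_, mem_pre_of hξ hη⟩}] with s hs
    exact (hS s ⟨_, mem_pre_of hξ hη⟩ (hs (by simp))).symm

end Abs
end OpSynth


namespace OpSynth
open Filter Topology

noncomputable section Bip
variable {H K : Type*}
  [NormedAddCommGroup H] [InnerProductSpace ℂ H]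
  [NormedAddCommGroup K] [InnerProductSpace ℂ K]

/-- vector functional -/
def vf (x : H) (y : K) : (H →L[ℂ] K) → ℂ := fun T => ⟪y, T x⟫

theorem nuc_vf_one {x : H} {y : K} (hx : ‖x‖ ≤ 1) (hy : ‖y‖ ≤ 1) : Nuc (vf x y) 1 := by
  have := nuc_of_countable (J := Unit) (ξ := fun _ => x) (η := fun _ => y) (r := 1)
    (hasSum_fintype _).summable (hasSum_fintype _).summable
    (by simp only [tsum_fintype]; simpa using hx) (by simp only [tsum_fintype]; simpa using hy)
  simpa [vf, Nuc] using this

theorem nuc_vf (x : H) (y : K) : Nuc (vf x y) (‖x‖ * ‖y‖) := by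
  have h1 : ‖((‖x‖⁻¹ : ℝ) : ℂ) • x‖ ≤ 1 := by
    rw [norm_smul, Complex.norm_real, norm_inv, norm_norm]
    exact inv_mul_le_one
  have h2 : ‖((‖y‖⁻¹ : ℝ) : ℂ) • y‖ ≤ 1 := by
    rw [norm_smul, Complex.norm_real, norm_inv, norm_norm]
    exact inv_mul_le_one
  have h := (nuc_vf_one h1 h2).smul ((‖x‖ * ‖y‖ : ℝ) : ℂ)
  rw [Complex.norm_real, norm_mul, norm_norm, norm_norm, mul_one] at h
  convert h using 1
  funext T
  simp only [vf, Pi.smul_apply, map_smul, inner_smul_left, inner_smul_right, Complex.conj_ofReal,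
    smul_eq_mul]
  by_cases hx : x = 0
  · simp [hx]
  by_cases hy : y = 0
  · simp [hy]
  have hx' : ((‖x‖ : ℝ) : ℂ) ≠ 0 := by simpa using hx
  have hy' : ((‖y‖ : ℝ) : ℂ) ≠ 0 := by simpa using hy
  push_cast
  field_simp

theorem vf_mem (x : H) (y : K) : vf x y ∈ Pre H K := ⟨_, nuc_vf x y⟩

theorem dual_op [CompleteSpace K] (G : Pre H K →ₗ[ℂ] ℂ)
    (hG : ∀ (φ : Pre H K) r, Nuc φ.1 r → ‖G φ‖ ≤ r) :
    ∃ T : H →L[ℂ] K, ∀ φ : Pre H K, G φ = φ.1 T := by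
  let ω (x : H) (y : K) : Pre H K := ⟨vf x y, vf_mem x y⟩
  have hω : ∀ x y, ‖G (ω x y)‖ ≤ ‖x‖ * ‖y‖ := fun x y => hG _ _ (nuc_vf x y)
  have a1 : ∀ x x' y, ω (x + x') y = ω x y + ω x' y := fun x x' y => by
    apply Subtype.ext; funext T; simp [ω, vf]
  have a2 : ∀ (c : ℂ) x y, ω (c • x) y = c • ω x y := fun c x y => by
    apply Subtype.ext; funext T; simp [ω, vf]
  have a3 : ∀ x y y', ω x (y + y') = ω x y + ω x y' := fun x x' y => by
    apply Subtype.ext; funext T; simp [ω, vf]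
  have a4 : ∀ (c : ℂ) x y, ω x (c • y) = (starRingEnd ℂ c) • ω x y := fun c x y => by
    apply Subtype.ext; funext T; simp [ω, vf, mul_comm]
  have ex : ∀ x, ∃ u : K, ∀ y, ⟪y, u⟫ = G (ω x y) := by
    intro x
    let l : K →ₗ[ℂ] ℂ :=
      { toFun := fun y => starRingEnd ℂ (G (ω x y))
        map_add' := by intro y y'; rw [a3, map_add, map_add]
        map_smul' := by intro c y; rw [a4, map_smul]; simp }
    let L : K →L[ℂ] ℂ := l.mkContinuous ‖x‖ (fun y => by
      show ‖starRingEnd ℂ (G (ω x y))‖ ≤ _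
      rw [RCLike.norm_conj]; exact hω x y)
    refine ⟨(InnerProductSpace.toDual ℂ K).symm L, fun y => ?_⟩
    rw [← inner_conj_symm, InnerProductSpace.toDual_symm_apply]
    show starRingEnd ℂ (starRingEnd ℂ (G (ω x y))) = _
    simp
  choose u hu using ex
  let t : H →ₗ[ℂ] K :=
    { toFun := u
      map_add' := fun x x' => ext_inner_left ℂ fun y => by
        rw [hu, a1, inner_add_right, hu, hu, map_add]
      map_smul' := fun c x => ext_inner_left ℂ fun y => by
        rw [hu, a2, RingHom.id_apply, inner_smul_right, hu, map_smul, smul_eq_mul] }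
  let T : H →L[ℂ] K := t.mkContinuous 1 (fun x => by
    rw [one_mul]
    show ‖u x‖ ≤ ‖x‖
    have h1 := hω x (u x)
    rw [← hu, inner_self_eq_norm_sq_to_K, norm_pow] at h1
    simp only [RCLike.norm_ofReal, abs_norm] at h1
    by_cases h0 : ‖u x‖ = 0
    · rw [h0]; positivity
    · have : 0 < ‖u x‖ := lt_of_le_of_ne (norm_nonneg _) (Ne.symm h0)
      nlinarith)
  refine ⟨T, fun φ => ?_⟩
  obtain ⟨r, ξ, η, hξ, hη, -, -, e⟩ := φ.2
  have t1 : Tendsto (fun N => ∑ n ∈ Finset.range N, ⟪η n, T (ξ n)⟫) atTop (𝓝 (φ.1 T)) := by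
    rw [e]; exact (cs_summable hξ hη T).hasSum.tendsto_sum_nat
  have t2 : Tendsto (fun N => ∑ n ∈ Finset.range N, ⟪η n, T (ξ n)⟫) atTop (𝓝 (G φ)) := by
    have s1 := tendsto_sum_nat_add (fun n => ‖ξ n‖ ^ 2)
    have s2 := tendsto_sum_nat_add (fun n => ‖η n‖ ^ 2)
    have s3 := s1.add s2
    rw [add_zero] at s3
    rw [tendsto_iff_norm_sub_tendsto_zero]
    refine squeeze_zero (fun _ => norm_nonneg _) (fun N => ?_) s3
    rw [norm_sub_rev]
    have : G φ - ∑ n ∈ Finset.range N, ⟪η n, T (ξ n)⟫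
        = G (φ - ∑ n ∈ Finset.range N, ω (ξ n) (η n)) := by
      rw [map_sub, map_sum]
      congr 1
      exact Finset.sum_congr rfl fun n _ => hu _ _
    rw [this]
    refine hG _ _ ⟨fun n => ξ (n + N), fun n => η (n + N),
      (summable_nat_add_iff N).2 hξ, (summable_nat_add_iff N).2 hη, ?_, ?_, ?_⟩
    · exact le_add_of_nonneg_right (tsum_nonneg fun n => by positivity)
    · exact le_add_of_nonneg_left (tsum_nonneg fun n => by positivity)
    · intro S
      have := (cs_summable hξ hη S).sum_add_tsum_nat_add N
      rw [← e] at this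
      simp only [Submodule.coe_sub, Submodule.coe_sum, Pi.sub_apply, Finset.sum_apply]
      rw [← this]
      simp [ω, vf]
  exact tendsto_nhds_unique t2 t1

/-- annihilator -/
def Ann (M : Submodule ℂ (H →L[ℂ] K)) : Submodule ℂ (Pre H K) where
  carrier := {φ | ∀ S ∈ M, φ.1 S = 0}
  add_mem' := by
    intro a b ha hb S hS
    simp [ha S hS, hb S hS]
  zero_mem' := by intro S hS; rfl
  smul_mem' := by
    intro c a ha S hS
    simp [ha S hS]

/-- quotient seminorm -/
def qs (N : Submodule ℂ (Pre H K)) : Seminorm ℂ (Pre H K) :=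
  Seminorm.ofSMulLE (fun φ => sInf {r | ∃ n ∈ N, Nuc (φ - n).1 r})
    (by
      apply le_antisymm
      · refine csInf_le ⟨0, ?_⟩ ⟨0, N.zero_mem, ?_⟩
        · rintro r ⟨n, -, h⟩; exact h.nonneg
        · simpa using (nuc_vf (0 : H) (0 : K)) |> fun h => (by
            have : (vf (0 : H) (0 : K)) = 0 := by funext T; simp [vf]
            rw [this] at h; simpa using h : Nuc (0 : (H →L[ℂ] K) → ℂ) 0)
      · refine Real.sInf_nonneg ?_
        rintro r ⟨n, -, h⟩; exact h.nonneg)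
    (by
      intro φ ψ
      have ne : ∀ φ : Pre H K, {r | ∃ n ∈ N, Nuc (φ - n).1 r}.Nonempty := fun φ => by
        obtain ⟨r, hr⟩ := φ.2
        exact ⟨r, 0, N.zero_mem, by simpa using hr⟩
      refine le_of_forall_pos_le_add fun ε hε => ?_
      obtain ⟨r, ⟨n, hn, hr⟩, hr'⟩ := Real.lt_sInf_add_pos (ne φ) (half_pos hε)
      obtain ⟨s, ⟨m, hm, hs⟩, hs'⟩ := Real.lt_sInf_add_pos (ne ψ) (half_pos hε)
      refine le_trans (csInf_le ⟨0, ?_⟩ (show r + s ∈ _ from ⟨n + m, N.add_mem hn hm, ?_⟩)) ?_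
      · rintro r ⟨n, -, h⟩; exact h.nonneg
      · have := hr.add hs
        convert this using 1
        show ((φ + ψ - (n + m) : Pre H K) : (H →L[ℂ] K) → ℂ) = ((φ - n + (ψ - m) : Pre H K) : _ → ℂ)
        congr 1; abel
      · linarith)
    (by
      intro c φ
      have ne : ∀ φ : Pre H K, {r | ∃ n ∈ N, Nuc (φ - n).1 r}.Nonempty := fun φ => by
        obtain ⟨r, hr⟩ := φ.2
        exact ⟨r, 0, N.zero_mem, by simpa using hr⟩
      refine le_of_forall_pos_le_add fun ε hε => ?_
      have hc : 0 < ‖c‖ + 1 := by positivity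
      obtain ⟨r, ⟨n, hn, hr⟩, hr'⟩ := Real.lt_sInf_add_pos (ne φ) (div_pos hε hc)
      refine le_trans (csInf_le ⟨0, ?_⟩ (show ‖c‖ * r ∈ _ from ⟨c • n, N.smul_mem c hn, ?_⟩)) ?_
      · rintro r ⟨n, -, h⟩; exact h.nonneg
      · have := hr.smul c
        convert this using 1
        show ((c • φ - c • n : Pre H K) : (H →L[ℂ] K) → ℂ) = ((c • (φ - n) : Pre H K) : _ → ℂ)
        rw [smul_sub]
      · calc ‖c‖ * r ≤ ‖c‖ * (sInf {r | ∃ n ∈ N, Nuc (φ - n).1 r} + ε / (‖c‖ + 1)) := by gcongr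
          _ = ‖c‖ * sInf {r | ∃ n ∈ N, Nuc (φ - n).1 r} + ε * (‖c‖ / (‖c‖ + 1)) := by ring
          _ ≤ _ := by
            gcongr
            have : ‖c‖ / (‖c‖ + 1) ≤ 1 := by rw [div_le_one hc]; linarith
            nlinarith)

theorem qs_le {N : Submodule ℂ (Pre H K)} {φ n : Pre H K} {r : ℝ} (hn : n ∈ N)
    (h : Nuc (φ - n).1 r) : qs N φ ≤ r :=
  csInf_le ⟨0, by rintro r ⟨n, -, h⟩; exact h.nonneg⟩ ⟨n, hn, h⟩

theorem le_qs {N : Submodule ℂ (Pre H K)} {φ : Pre H K} {ε : ℝ}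
    (h : ∀ n ∈ N, ¬ Nuc (φ - n).1 ε) : ε ≤ qs N φ := by
  refine le_csInf ?_ ?_
  · obtain ⟨r, hr⟩ := φ.2
    exact ⟨r, 0, N.zero_mem, by simpa using hr⟩
  · rintro r ⟨n, hn, hr⟩
    by_contra hc
    exact h n hn (hr.mono (not_le.1 hc).le)

theorem bipolar [CompleteSpace K] (M1 M2 : Submodule ℂ (H →L[ℂ] K)) (x : H) (y : K)
    (h : ∀ S ∈ wkClosure (M1 : Set (H →L[ℂ] K)) ∩ wkClosure (M2 : Set (H →L[ℂ] K)), ⟪y, S x⟫ = 0)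
    {ε : ℝ} (hε : 0 < ε) :
    ∃ p1 ∈ Ann M1, ∃ p2 ∈ Ann M2, Nuc (fun T => ⟪y, T x⟫ - p1.1 T - p2.1 T) ε := by
  set N := Ann M1 ⊔ Ann M2
  set w : Pre H K := ⟨vf x y, vf_mem x y⟩
  by_cases hN : ∃ n ∈ N, Nuc (w - n).1 ε
  · obtain ⟨n, hn, hr⟩ := hN
    obtain ⟨p1, h1, p2, h2, rfl⟩ := Submodule.mem_sup.1 hn
    refine ⟨p1, h1, p2, h2, ?_⟩
    convert hr using 1
    funext T
    simp [w, vf]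
    ring
  exfalso
  push Not at hN
  have hw := lt_of_lt_of_le hε (le_qs hN)
  have w0 : w ≠ 0 := by rintro h0; rw [h0, map_zero] at hw; exact lt_irrefl _ hw
  let f : (Submodule.span ℂ {w}) →ₗ[ℂ] ℂ :=
    ((qs N w : ℝ) : ℂ) • (LinearEquiv.coord ℂ (Pre H K) w w0).toLinearMap
  obtain ⟨G, hG1, hG2⟩ := Module.Dual.exists_extension_of_le_seminorm (Submodule.span ℂ {w}) f
    (p := qs N) (by
      rintro ⟨z, hz⟩
      obtain ⟨c, rfl⟩ := Submodule.mem_span_singleton.1 hz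
      have : LinearEquiv.coord ℂ (Pre H K) w w0 ⟨c • w, hz⟩ = c := by
        rw [show (⟨c • w, hz⟩ : Submodule.span ℂ {w}) = c • ⟨w, Submodule.mem_span_singleton_self w⟩ from rfl,
          map_smul, LinearEquiv.coord_self, smul_eq_mul, mul_one]
      show ‖((qs N w : ℝ) : ℂ) • LinearEquiv.coord ℂ (Pre H K) w w0 ⟨c • w, hz⟩‖ ≤ _
      rw [this, norm_smul, map_smul_eq_mul, Complex.norm_real, Real.norm_of_nonneg hw.le, mul_comm])
  have hGw : G w = ((qs N w : ℝ) : ℂ) := by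
    have := hG1 ⟨w, Submodule.mem_span_singleton_self w⟩
    refine this.trans ?_
    show ((qs N w : ℝ) : ℂ) • LinearEquiv.coord ℂ (Pre H K) w w0 _ = _
    rw [LinearEquiv.coord_self]; simp
  obtain ⟨T, hT⟩ := dual_op G (fun φ r hr => (hG2 φ).trans
    (qs_le (N := N) (n := 0) N.zero_mem (by simpa using hr)))
  have hGN : ∀ n ∈ N, n.1 T = 0 := by
    intro n hn
    rw [← hT]
    have h1 := hG2 n
    have h2 : qs N n ≤ 0 := qs_le hn (by
      have h := nuc_vf (0 : H) (0 : K)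
      have h0 : (vf (0 : H) (0 : K)) = 0 := by funext T; simp [vf]
      rw [h0] at h; simpa using h)
    exact norm_le_zero_iff.1 (h1.trans h2)
  have hTm : ⟪y, T x⟫ = 0 := by
    refine h T ⟨?_, ?_⟩
    · rw [mem_wkClosure_iff]
      intro φ hφ h0
      exact hGN ⟨φ, hφ⟩ (Submodule.mem_sup_left (show _ ∈ Ann M1 from h0))
    · rw [mem_wkClosure_iff]
      intro φ hφ h0
      exact hGN ⟨φ, hφ⟩ (Submodule.mem_sup_right (show _ ∈ Ann M2 from h0))
  have := hT w
  rw [hGw] at this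
  have h3 : ((qs N w : ℝ) : ℂ) = 0 := this.trans hTm
  exact hw.ne' (by exact_mod_cast h3)

end Bip
end OpSynth


set_option linter.unusedSectionVars false
namespace OpSynth
open Filter Topology

noncomputable section Slices
variable {H K T H₁ H₂ K₁ K₂ T₁ T₂ : Type*}
  [NormedAddCommGroup H] [InnerProductSpace ℂ H] [CompleteSpace H]
  [NormedAddCommGroup K] [InnerProductSpace ℂ K] [CompleteSpace K]
  [NormedAddCommGroup T] [InnerProductSpace ℂ T] [CompleteSpace T]
  [NormedAddCommGroup H₁] [InnerProductSpace ℂ H₁] [CompleteSpace H₁]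
  [NormedAddCommGroup H₂] [InnerProductSpace ℂ H₂] [CompleteSpace H₂]
  [NormedAddCommGroup K₁] [InnerProductSpace ℂ K₁] [CompleteSpace K₁]
  [NormedAddCommGroup K₂] [InnerProductSpace ℂ K₂] [CompleteSpace K₂]
  [NormedAddCommGroup T₁] [InnerProductSpace ℂ T₁] [CompleteSpace T₁]
  [NormedAddCommGroup T₂] [InnerProductSpace ℂ T₂] [CompleteSpace T₂]

theorem IsTensorEmbedding.swap {t : H → K → T} (ht : IsTensorEmbedding t) :
    IsTensorEmbedding (fun y x => t x y) := by
  obtain ⟨h1, h2, h3, h4, h5, h6⟩ := ht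
  refine ⟨fun x x' y => h2 _ _ _, fun x x' y => h1 _ _ _, fun x x' y => h4 _ _ _,
    fun x x' y => h3 _ _ _, fun x x' y y' => (h5 _ _ _ _).trans (mul_comm _ _), ?_⟩
  rw [← h6]
  congr 3
  ext z
  exact exists_comm

theorem IsTensorEmbedding.norm {t : H → K → T} (ht : IsTensorEmbedding t) (x : H) (y : K) :
    ‖t x y‖ = ‖x‖ * ‖y‖ := by
  have h := ht.2.2.2.2.1 x x y y
  rw [inner_self_eq_norm_sq_to_K, inner_self_eq_norm_sq_to_K, inner_self_eq_norm_sq_to_K] at h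
  have h' : ‖t x y‖ ^ 2 = (‖x‖ * ‖y‖) ^ 2 := by
    rw [mul_pow]; exact_mod_cast h
  exact (sq_eq_sq₀ (norm_nonneg _) (by positivity)).1 h'

theorem IsTensorEmbedding.dense {t : H → K → T} (ht : IsTensorEmbedding t) :
    Dense (Submodule.span ℂ { z | ∃ x y, z = t x y } : Set T) :=
  Submodule.dense_iff_topologicalClosure_eq_top.2 ht.2.2.2.2.2

theorem IsTensorEmbedding.ext {E : Type*} [NormedAddCommGroup E] [InnerProductSpace ℂ E]
    {t : H → K → T} (ht : IsTensorEmbedding t) {A B : T →L[ℂ] E}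
    (h : ∀ x y, A (t x y) = B (t x y)) : A = B := by
  refine ContinuousLinearMap.ext_on ht.dense ?_
  rintro _ ⟨x, y, rfl⟩
  exact h x y

/-- amplification by a vector -/
def Jop {t : H → K → T} (ht : IsTensorEmbedding t) (a : K) : H →L[ℂ] T :=
  LinearMap.mkContinuous
    { toFun := fun x => t x a
      map_add' := fun x x' => ht.1 x x' a
      map_smul' := fun c x => ht.2.2.1 c x a } ‖a‖
    (fun x => by
      show ‖t x a‖ ≤ _
      rw [ht.norm, mul_comm])

theorem Jop_apply {t : H → K → T} (ht : IsTensorEmbedding t) (a : K) (x : H) :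
    Jop ht a x = t x a := rfl

theorem Jadj_apply {t : H → K → T} (ht : IsTensorEmbedding t) (a : K) (x : H) (y : K) :
    (Jop ht a).adjoint (t x y) = ⟪a, y⟫ • x := by
  refine ext_inner_left ℂ fun z => ?_
  rw [ContinuousLinearMap.adjoint_inner_right, Jop_apply, ht.2.2.2.2.1, inner_smul_right, mul_comm]

/-- finite rank cut-off -/
def Pop {t : H → K → T} (ht : IsTensorEmbedding t) {ι : Type*} (e : ι → K) (F : Finset ι) :
    T →L[ℂ] T := ∑ i ∈ F, (Jop ht (e i)) ∘L (Jop ht (e i)).adjoint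

theorem Pop_inner {t : H → K → T} (ht : IsTensorEmbedding t) {ι : Type*} (e : ι → K)
    (F : Finset ι) (u v : T) : ⟪Pop ht e F u, v⟫ = ⟪u, Pop ht e F v⟫ := by
  simp only [Pop, sum_apply, sum_inner, inner_sum, ContinuousLinearMap.comp_apply]
  refine Finset.sum_congr rfl fun i _ => ?_
  rw [← ContinuousLinearMap.adjoint_inner_right, ContinuousLinearMap.adjoint_inner_left]

theorem Pop_tensor {t : H → K → T} (ht : IsTensorEmbedding t) {ι : Type*} (e : ι → K)
    (F : Finset ι) (x : H) (y : K) :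
    Pop ht e F (t x y) = t x (∑ i ∈ F, ⟪e i, y⟫ • e i) := by
  have := map_sum (Jop ht.swap x) (fun i => ⟪e i, y⟫ • e i) F
  rw [Jop_apply] at this
  rw [this]
  simp only [Pop, sum_apply, ContinuousLinearMap.comp_apply, Jadj_apply, Jop_apply]
  refine Finset.sum_congr rfl fun i _ => ?_
  rw [ht.2.2.1, ht.2.2.2.1]

theorem Pop_norm {t : H → K → T} (ht : IsTensorEmbedding t) {ι : Type*} {e : ι → K}
    (he : Orthonormal ℂ e) (F : Finset ι) : ‖Pop ht e F‖ ≤ 1 := by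
  classical
  have idem : (Pop ht e F) ∘L (Pop ht e F) = Pop ht e F := by
    refine ht.ext fun x y => ?_
    rw [ContinuousLinearMap.comp_apply, Pop_tensor, Pop_tensor]
    congr 1
    refine Finset.sum_congr rfl fun i hi => ?_
    congr 1
    exact he.inner_right_sum (fun i => ⟪e i, y⟫) hi
  refine ContinuousLinearMap.opNorm_le_bound _ zero_le_one fun z => ?_
  rw [one_mul]
  have h1 : ‖Pop ht e F z‖ ^ 2 ≤ ‖z‖ * ‖Pop ht e F z‖ := by
    have h2 : ⟪Pop ht e F z, Pop ht e F z⟫ = ⟪z, Pop ht e F z⟫ := by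
      rw [Pop_inner, ← ContinuousLinearMap.comp_apply, idem]
    have h3 := norm_inner_le_norm (𝕜 := ℂ) z (Pop ht e F z)
    rw [← h2, inner_self_eq_norm_sq_to_K, norm_pow] at h3
    simpa using h3
  by_cases h0 : ‖Pop ht e F z‖ = 0
  · rw [h0]; positivity
  · have : 0 < ‖Pop ht e F z‖ := lt_of_le_of_ne (norm_nonneg _) (Ne.symm h0)
    nlinarith

theorem tendsto_of_span {t : H → K → T} (ht : IsTensorEmbedding t) {ι : Type*} {l : Filter ι}
    {P : ι → T →L[ℂ] T} (hP : ∀ i, ‖P i‖ ≤ 1)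
    (h : ∀ x y, Tendsto (fun i => P i (t x y)) l (𝓝 (t x y))) (z : T) :
    Tendsto (fun i => P i z) l (𝓝 z) := by
  have hs : ∀ z ∈ Submodule.span ℂ { z | ∃ x y, z = t x y }, Tendsto (fun i => P i z) l (𝓝 z) := by
    intro z hz
    induction hz using Submodule.span_induction with
    | mem z hz => obtain ⟨x, y, rfl⟩ := hz; exact h x y
    | zero => simpa using tendsto_const_nhds
    | add a b _ _ ha hb => simpa using ha.add hb
    | smul c a _ ha => simpa using ha.const_smul c
  rw [Metric.tendsto_nhds]
  intro ε hε
  obtain ⟨z', hz', hd⟩ := Metric.mem_closure_iff.1 (ht.dense z) (ε / 3) (by positivity)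
  filter_upwards [(Metric.tendsto_nhds.1 (hs z' hz')) (ε / 3) (by positivity)] with i hi
  have h1 : dist (P i z) (P i z') < ε / 3 := by
    rw [dist_eq_norm, ← map_sub]
    refine lt_of_le_of_lt ((P i).le_opNorm _) ?_
    rw [dist_eq_norm] at hd
    have := hP i
    nlinarith [norm_nonneg (z - z')]
  have h2 : dist z' z < ε / 3 := by rwa [dist_comm]
  linarith [dist_triangle (P i z) (P i z') z, dist_triangle (P i z') z' z]

theorem Pop_tendsto {t : H → K → T} (ht : IsTensorEmbedding t) {ι : Type*}
    (b : HilbertBasis ι ℂ K) (z : T) : Tendsto (fun F => Pop ht b F z) atTop (𝓝 z) := by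
  refine tendsto_of_span ht (fun F => Pop_norm ht b.orthonormal F) ?_ z
  intro x y
  simp only [Pop_tensor]
  have h := b.hasSum_repr y
  have h2 := ((Jop ht.swap x).continuous.tendsto y).comp h
  refine h2.congr fun F => ?_
  simp only [Function.comp, Jop_apply, b.repr_apply_apply]

/-- slice -/
def slice {t₁ : H₁ → K₁ → T₁} {t₂ : H₂ → K₂ → T₂} (ht₁ : IsTensorEmbedding t₁)
    (ht₂ : IsTensorEmbedding t₂) (A : T₁ →L[ℂ] T₂) (a : K₁) (b : K₂) : H₁ →L[ℂ] H₂ :=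
  (Jop ht₂ b).adjoint ∘L A ∘L (Jop ht₁ a)

theorem elem_J {t₁ : H₁ → K₁ → T₁} {t₂ : H₂ → K₂ → T₂} (ht₁ : IsTensorEmbedding t₁)
    (ht₂ : IsTensorEmbedding t₂) (S : H₁ →L[ℂ] H₂) (a : K₁) (b : K₂) :
    IsElemTensor t₁ t₂ (Jop ht₂ b ∘L S ∘L (Jop ht₁ a).adjoint) S
      ((innerSL ℂ a).smulRight b) := by
  intro x y
  simp only [ContinuousLinearMap.comp_apply, Jadj_apply, map_smul, Jop_apply]
  simp [ht₂.2.2.2.1]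

theorem mem_wTensor_of_slices {t₁ : H₁ → K₁ → T₁} {t₂ : H₂ → K₂ → T₂}
    (ht₁ : IsTensorEmbedding t₁) (ht₂ : IsTensorEmbedding t₂) (V : Set (H₁ →L[ℂ] H₂))
    (A : T₁ →L[ℂ] T₂) (h : ∀ a b, slice ht₁ ht₂ A a b ∈ V) : A ∈ wTensor t₁ t₂ V univ := by
  classical
  obtain ⟨w₁, b₁, -⟩ := exists_hilbertBasis ℂ K₁
  obtain ⟨w₂, b₂, -⟩ := exists_hilbertBasis ℂ K₂
  let := sigmaWeak T₁ T₂
  have key : Tendsto (fun p : Finset w₁ × Finset w₂ => Pop ht₂ b₂ p.2 ∘L A ∘L Pop ht₁ b₁ p.1)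
      (atTop ×ˢ atTop) (@nhds _ (sigmaWeak T₁ T₂) A) := by
    refine tendsto_sw_of_bdd ‖A‖ (fun p => ?_) (fun x y => ?_)
    · refine (ContinuousLinearMap.opNorm_comp_le _ _).trans ?_
      have h1 := ContinuousLinearMap.opNorm_comp_le A (Pop ht₁ b₁ p.1)
      have h2 := Pop_norm ht₁ b₁.orthonormal p.1
      have h3 := Pop_norm ht₂ b₂.orthonormal p.2
      have h4 : ‖A ∘L Pop ht₁ b₁ p.1‖ ≤ ‖A‖ :=
        h1.trans (mul_le_of_le_one_right (norm_nonneg _) h2)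
      exact (mul_le_of_le_one_left (norm_nonneg _) h3).trans h4
    · simp only [ContinuousLinearMap.comp_apply, ← Pop_inner]
      have t1 := (Pop_tendsto ht₁ b₁ x).comp (tendsto_fst (f := atTop) (g := (atTop : Filter (Finset w₂))))
      have t2 := (Pop_tendsto ht₂ b₂ y).comp (tendsto_snd (f := (atTop : Filter (Finset w₁))) (g := atTop))
      exact t2.inner ((A.continuous.tendsto x).comp t1)
  refine mem_closure_of_tendsto key (Eventually.of_forall fun p => ?_)
  have : Pop ht₂ b₂ p.2 ∘L A ∘L Pop ht₁ b₁ p.1 = ∑ i ∈ p.2, ∑ j ∈ p.1,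
      Jop ht₂ (b₂ i) ∘L (slice ht₁ ht₂ A (b₁ j) (b₂ i)) ∘L (Jop ht₁ (b₁ j)).adjoint := by
    ext z
    simp only [Pop, sum_apply, ContinuousLinearMap.comp_apply, map_sum, slice]
    exact Finset.sum_comm
  rw [this]
  refine Submodule.sum_mem _ fun i _ => Submodule.sum_mem _ fun j _ => ?_
  exact Submodule.subset_span ⟨_, h _ _, _, mem_univ _, elem_J ht₁ ht₂ _ _ _⟩

theorem inner_zero_of_slices {t₁ : H₁ → K₁ → T₁} {t₂ : H₂ → K₂ → T₂}
    (ht₁ : IsTensorEmbedding t₁) (ht₂ : IsTensorEmbedding t₂) (U : Set (H₁ →L[ℂ] H₂))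
    (A : T₁ →L[ℂ] T₂) (hA : ∀ a b, slice ht₁ ht₂ A a b ∈ RefHull U) (F : T₁) (G : T₂)
    (h : ∀ S ∈ wTensor t₁ t₂ U univ, ⟪S F, G⟫ = 0) : ⟪A F, G⟫ = 0 := by
  have h' : ∀ S ∈ U, ∀ a b, ⟪S ((Jop ht₁ a).adjoint F), (Jop ht₂ b).adjoint G⟫ = 0 := by
    intro S hS a b
    rw [ContinuousLinearMap.adjoint_inner_right]
    refine h (Jop ht₂ b ∘L S ∘L (Jop ht₁ a).adjoint) ?_
    let := sigmaWeak T₁ T₂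
    exact subset_closure (Submodule.subset_span ⟨_, hS, _, mem_univ _, elem_J ht₁ ht₂ _ _ _⟩)
  have h2 : ∀ a b, ⟪A (Jop ht₁ a ((Jop ht₁ a).adjoint F)), Jop ht₂ b ((Jop ht₂ b).adjoint G)⟫ = 0 := by
    intro a b
    have hm := hA a b ((Jop ht₁ a).adjoint F)
    have hc : IsClosed {u : H₂ | ⟪u, (Jop ht₂ b).adjoint G⟫ = 0} :=
      isClosed_eq (by fun_prop) continuous_const
    have := closure_minimal (by rintro _ ⟨S, hS, rfl⟩; exact h' S hS a b) hc hm
    simpa [slice, ContinuousLinearMap.adjoint_inner_left] using this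
  classical
  obtain ⟨w₁, b₁, -⟩ := exists_hilbertBasis ℂ K₁
  obtain ⟨w₂, b₂, -⟩ := exists_hilbertBasis ℂ K₂
  have key : Tendsto (fun p : Finset w₁ × Finset w₂ =>
      ⟪A (Pop ht₁ b₁ p.1 F), Pop ht₂ b₂ p.2 G⟫) (atTop ×ˢ atTop) (𝓝 ⟪A F, G⟫) := by
    have t1 := (Pop_tendsto ht₁ b₁ F).comp (tendsto_fst (f := atTop) (g := (atTop : Filter (Finset w₂))))
    have t2 := (Pop_tendsto ht₂ b₂ G).comp (tendsto_snd (f := (atTop : Filter (Finset w₁))) (g := atTop))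
    exact ((A.continuous.tendsto F).comp t1).inner t2
  refine tendsto_nhds_unique key (tendsto_const_nhds.congr fun p => ?_)
  simp only [Pop, sum_apply, ContinuousLinearMap.comp_apply, map_sum, sum_inner, inner_sum]
  symm
  refine Finset.sum_eq_zero fun i _ => Finset.sum_eq_zero fun j _ => ?_
  exact h2 _ _

end Slices
end OpSynth


set_option linter.unusedSectionVars false
namespace OpSynth
open Filter Topology

noncomputable section CompCont
variable {H K H' K' : Type*}
  [NormedAddCommGroup H] [InnerProductSpace ℂ H] [CompleteSpace H]
  [NormedAddCommGroup K] [InnerProductSpace ℂ K] [CompleteSpace K]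
  [NormedAddCommGroup H'] [InnerProductSpace ℂ H'] [CompleteSpace H']
  [NormedAddCommGroup K'] [InnerProductSpace ℂ K'] [CompleteSpace K']

theorem summable_map (A : H →L[ℂ] K) {ξ : ℕ → H} (h : Summable fun n => ‖ξ n‖ ^ 2) :
    Summable fun n => ‖A (ξ n)‖ ^ 2 := by
  refine Summable.of_nonneg_of_le (fun n => by positivity) (fun n => ?_) (h.mul_left (‖A‖ ^ 2))
  rw [← mul_pow]
  gcongr
  exact A.le_opNorm _

theorem comp_cont (A : H' →L[ℂ] H) (B : K →L[ℂ] K') :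
    @Continuous _ _ (sigmaWeak H K) (sigmaWeak H' K') (fun S : H →L[ℂ] K => B ∘L S ∘L A) := by
  let i1 := sigmaWeak H K
  let i2 := sigmaWeak H' K'
  rw [continuous_iff_continuousAt]
  intro S
  refine tendsto_sw.2 fun ξ η hξ hη => ?_
  have := (tendsto_sw (f := id) (l := 𝓝 S)).1 tendsto_id (fun n => A (ξ n))
    (fun n => B.adjoint (η n)) (summable_map A hξ) (summable_map _ hη)
  simpa [ContinuousLinearMap.adjoint_inner_left] using this

/-- weak* closure as submodule -/
def wSub (M : Submodule ℂ (H →L[ℂ] K)) : Submodule ℂ (H →L[ℂ] K) where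
  carrier := wkClosure (M : Set (H →L[ℂ] K))
  add_mem' := by
    intro a b ha hb
    rw [mem_wkClosure_iff] at *
    intro φ hφ h0
    rw [(pre_isLinear hφ).map_add, ha φ hφ h0, hb φ hφ h0, add_zero]
  zero_mem' := by
    let i1 := sigmaWeak H K
    exact subset_closure M.zero_mem
  smul_mem' := by
    intro c a ha
    rw [mem_wkClosure_iff] at *
    intro φ hφ h0
    rw [(pre_isLinear hφ).map_smul, ha φ hφ h0, smul_zero]

theorem wSub_closed (M : Submodule ℂ (H →L[ℂ] K)) : WkClosed (wSub M : Set (H →L[ℂ] K)) := by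
  let i1 := sigmaWeak H K
  exact isClosed_closure

theorem le_wSub (M : Submodule ℂ (H →L[ℂ] K)) : M ≤ wSub M := by
  let i1 := sigmaWeak H K
  exact fun x hx => subset_closure hx

/-- minimality: a weak* continuous operation preserving generators -/
theorem comp_mem_span {G : Set (H →L[ℂ] K)} (A : H →L[ℂ] H) (B : K →L[ℂ] K)
    (h : ∀ S ∈ G, B ∘L S ∘L A ∈ wSub (Submodule.span ℂ G)) :
    ∀ S ∈ wSub (Submodule.span ℂ G), B ∘L S ∘L A ∈ wSub (Submodule.span ℂ G) := by
  have h1 : ∀ S ∈ Submodule.span ℂ G, B ∘L S ∘L A ∈ wSub (Submodule.span ℂ G) := by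
    intro S hS
    induction hS using Submodule.span_induction with
    | mem S hS => exact h S hS
    | zero => simp
    | add a b _ _ ha hb =>
      have : B ∘L (a + b) ∘L A = B ∘L a ∘L A + B ∘L b ∘L A := by ext; simp
      rw [this]; exact add_mem ha hb
    | smul c a _ ha =>
      have : B ∘L (c • a) ∘L A = c • (B ∘L a ∘L A) := by ext; simp
      rw [this]; exact Submodule.smul_mem _ _ ha
  intro S hS
  let i1 := sigmaWeak H K
  have hc : IsClosed {S : H →L[ℂ] K | B ∘L S ∘L A ∈ wSub (Submodule.span ℂ G)} :=
    IsClosed.preimage (comp_cont A B) (wSub_closed _)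
  exact closure_minimal (s := (Submodule.span ℂ G : Set (H →L[ℂ] K))) (fun S hS => h1 S hS) hc hS

end CompCont

noncomputable section Mult
variable {X Y : Type*} [MeasurableSpace X] [MeasurableSpace Y] {μ : Measure X} {ν : Measure Y}

theorem mulS_memLp (φ : SimpleFunc X ℂ) (f : Lp ℂ 2 μ) : MemLp (fun x => φ x * f x) 2 μ := by
  obtain ⟨C, hC⟩ := φ.exists_forall_norm_le
  refine MemLp.of_le_mul (c := C) (Lp.memLp f)
    (φ.measurable.aestronglyMeasurable.mul (Lp.aestronglyMeasurable f)) (Eventually.of_forall fun x => ?_)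
  rw [norm_mul]
  gcongr
  exact hC x

/-- multiplication by a simple function -/
def mulS (φ : SimpleFunc X ℂ) : Lp ℂ 2 μ →L[ℂ] Lp ℂ 2 μ :=
  LinearMap.mkContinuous
    { toFun := fun f => (mulS_memLp φ f).toLp _
      map_add' := fun f g => by
        apply Lp.ext
        filter_upwards [(mulS_memLp φ (f + g)).coeFn_toLp, (mulS_memLp φ f).coeFn_toLp,
          (mulS_memLp φ g).coeFn_toLp, Lp.coeFn_add f g,
          Lp.coeFn_add ((mulS_memLp φ f).toLp _) ((mulS_memLp φ g).toLp _)] with x h1 h2 h3 h4 h5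
        rw [h1, h5, Pi.add_apply, h2, h3, h4, Pi.add_apply, mul_add]
      map_smul' := fun c f => by
        apply Lp.ext
        filter_upwards [(mulS_memLp φ (c • f)).coeFn_toLp, (mulS_memLp φ f).coeFn_toLp,
          Lp.coeFn_smul c f, Lp.coeFn_smul c ((mulS_memLp φ f).toLp _)] with x h1 h2 h3 h4
        rw [h1, RingHom.id_apply, h4, Pi.smul_apply, h2, h3, Pi.smul_apply, smul_eq_mul, smul_eq_mul]
        ring }
    φ.exists_forall_norm_le.choose
    (fun f => by
      apply Lp.norm_le_mul_norm_of_ae_le_mul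
      filter_upwards [(mulS_memLp φ f).coeFn_toLp] with x h1
      show ‖(mulS_memLp φ f).toLp _ x‖ ≤ _
      rw [h1, norm_mul]
      gcongr
      exact φ.exists_forall_norm_le.choose_spec x)

theorem mulS_coe (φ : SimpleFunc X ℂ) (f : Lp ℂ 2 μ) : ⇑(mulS φ f) =ᵐ[μ] fun x => φ x * f x :=
  (mulS_memLp φ f).coeFn_toLp

theorem mulS_isMult (φ : SimpleFunc X ℂ) : IsMultOp μ (mulS φ) := by
  obtain ⟨C, hC⟩ := φ.exists_forall_norm_le
  exact ⟨φ, φ.measurable.aestronglyMeasurable, ⟨C, Eventually.of_forall hC⟩, mulS_coe φ⟩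

theorem mulS_add (φ ψ : SimpleFunc X ℂ) : mulS (μ := μ) (φ + ψ) = mulS φ + mulS ψ := by
  ext1 f
  apply Lp.ext
  rw [add_apply]
  filter_upwards [mulS_coe (φ + ψ) f, mulS_coe φ f, mulS_coe ψ f,
    Lp.coeFn_add (mulS φ f) (mulS ψ f)] with x h1 h2 h3 h4
  rw [h1, h4, Pi.add_apply, h2, h3, SimpleFunc.coe_add, Pi.add_apply, add_mul]

theorem mulS_inner (φ : SimpleFunc X ℂ) (f g : Lp ℂ 2 μ) :
    ⟪mulS φ f, g⟫ = ⟪f, mulS (φ.map (starRingEnd ℂ)) g⟫ := by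
  rw [L2.inner_def, L2.inner_def]
  apply integral_congr_ae
  filter_upwards [mulS_coe φ f, mulS_coe (φ.map (starRingEnd ℂ)) g] with x h1 h2
  rw [h1, h2]
  simp
  ring

/-- indicator -/
def indS (E : Set X) (hE : MeasurableSet E) : SimpleFunc X ℂ :=
  SimpleFunc.piecewise E hE (SimpleFunc.const X 1) (SimpleFunc.const X 0)

theorem indS_apply (E : Set X) (hE : MeasurableSet E) (x : X) :
    indS E hE x = E.indicator 1 x := by
  classical
  simp [indS, SimpleFunc.coe_piecewise, Set.piecewise, Set.indicator]

/-- multiplication by an indicator -/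
def mE (E : Set X) (hE : MeasurableSet E) : Lp ℂ 2 μ →L[ℂ] Lp ℂ 2 μ := mulS (indS E hE)

theorem mE_coe (E : Set X) (hE : MeasurableSet E) (f : Lp ℂ 2 μ) :
    ⇑(mE E hE f) =ᵐ[μ] E.indicator f := by
  filter_upwards [mulS_coe (indS E hE) f] with x hx
  rw [mE, hx, indS_apply]
  by_cases h : x ∈ E <;> simp [h]

theorem mE_inner (E : Set X) (hE : MeasurableSet E) (f g : Lp ℂ 2 μ) :
    ⟪mE E hE f, g⟫ = ⟪f, mE E hE g⟫ := by
  rw [L2.inner_def, L2.inner_def]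
  apply integral_congr_ae
  filter_upwards [mE_coe E hE f, mE_coe E hE g] with x h1 h2
  rw [h1, h2]
  by_cases h : x ∈ E <;> simp [h]

theorem mE_norm (E : Set X) (hE : MeasurableSet E) : ‖mE (μ := μ) E hE‖ ≤ 1 := by
  refine ContinuousLinearMap.opNorm_le_bound _ zero_le_one fun f => ?_
  apply Lp.norm_le_mul_norm_of_ae_le_mul
  filter_upwards [mE_coe E hE f] with x hx
  rw [hx, one_mul]
  exact norm_indicator_le_norm_self _ _

theorem mE_fix {E : Set X} (hE : MeasurableSet E) {f : Lp ℂ 2 μ}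
    (h : ∀ᵐ x ∂μ, x ∉ E → f x = 0) : mE E hE f = f := by
  apply Lp.ext
  filter_upwards [mE_coe E hE f, h] with x hx h'
  rw [hx]
  by_cases hm : x ∈ E
  · simp [hm]
  · simp [hm, h' hm]

theorem mE_vanish (E : Set X) (hE : MeasurableSet E) (f : Lp ℂ 2 μ) :
    ∀ᵐ x ∂μ, x ∉ E → mE E hE f x = 0 := by
  filter_upwards [mE_coe E hE f] with x hx h'
  rw [hx]; simp [h']

theorem inner_mE (E : Set X) (hE : MeasurableSet E) (f g : Lp ℂ 2 μ) :
    ⟪f, mE E hE g⟫ = ∫ x in E, ⟪f x, g x⟫ ∂μ := by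
  rw [L2.inner_def, ← integral_indicator hE]
  apply integral_congr_ae
  filter_upwards [mE_coe E hE g] with x h1
  rw [h1]
  by_cases h : x ∈ E <;> simp [h]

theorem mE_compl (E : Set X) (hE : MeasurableSet E) :
    mE (μ := μ) Eᶜ hE.compl = 1 - mE E hE := by
  ext1 f
  apply Lp.ext
  rw [sub_apply, one_apply_eq_self]
  filter_upwards [mE_coe E hE f, mE_coe Eᶜ hE.compl f, Lp.coeFn_sub f (mE E hE f)] with x h1 h2 h3
  rw [h2, h3, Pi.sub_apply, h1]
  by_cases h : x ∈ E <;> simp [h]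

theorem mE_empty : mE (μ := μ) ∅ MeasurableSet.empty = 0 := by
  ext1 f
  apply Lp.ext
  rw [zero_apply]
  filter_upwards [mE_coe ∅ MeasurableSet.empty f, Lp.coeFn_zero ℂ 2 μ] with x h1 h2
  rw [h1, h2]
  simp

theorem mE_union {E F : Set X} (hE : MeasurableSet E) (hF : MeasurableSet F) (hd : Disjoint E F) :
    mE (μ := μ) (E ∪ F) (hE.union hF) = mE E hE + mE F hF := by
  ext1 f
  apply Lp.ext
  rw [add_apply]
  filter_upwards [mE_coe E hE f, mE_coe F hF f, mE_coe (E ∪ F) (hE.union hF) f,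
    Lp.coeFn_add (mE E hE f) (mE F hF f)] with x h1 h2 h3 h4
  rw [h3, h4, Pi.add_apply, h1, h2, indicator_union_of_disjoint hd]

/-- π-λ argument -/
theorem pi_lambda {μ : Measure X} {ν : Measure Y}
    (D : Submodule ℂ (Lp ℂ 2 (μ.prod ν) →L[ℂ] Lp ℂ 2 (μ.prod ν)))
    (hD : WkClosed (D : Set (Lp ℂ 2 (μ.prod ν) →L[ℂ] Lp ℂ 2 (μ.prod ν)))) (h1 : 1 ∈ D)
    (hr : ∀ P Q (hP : MeasurableSet P) (hQ : MeasurableSet Q), mE (P ×ˢ Q) (hP.prod hQ) ∈ D)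
    (φ : SimpleFunc (X × Y) ℂ) : mulS φ ∈ D := by
  have key : ∀ E (hE : MeasurableSet E), mE E hE ∈ D := by
    intro E hE
    induction E, hE using MeasurableSpace.induction_on_inter generateFrom_prod.symm isPiSystem_prod with
    | empty => rw [mE_empty]; exact D.zero_mem
    | basic E hE =>
      obtain ⟨P, hP, Q, hQ, rfl⟩ := hE
      exact hr P Q hP hQ
    | compl E hE ih => rw [mE_compl E hE]; exact D.sub_mem h1 ih
    | iUnion f hd hm ih =>
      have hmu : ∀ n, MeasurableSet (⋃ i ∈ Finset.range n, f i) := fun n =>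
        Finset.measurableSet_biUnion _ fun i _ => hm i
      have fin : ∀ n, mE (⋃ i ∈ Finset.range n, f i) (hmu n) ∈ D := by
        intro n
        induction n with
        | zero =>
          have : ∀ (S : Set (X × Y)) (hS : MeasurableSet S), S = ∅ → mE S hS ∈ D := by
            rintro S hS rfl
            rw [mE_empty]; exact D.zero_mem
          exact this _ _ (by simp)
        | succ n ihn =>
          have : ∀ (S : Set (X × Y)) (hS : MeasurableSet S),
              S = (⋃ i ∈ Finset.range n, f i) ∪ f n → mE S hS ∈ D := by
            rintro S hS rfl
            rw [mE_union (hmu n) (hm n)]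
            · exact D.add_mem ihn (ih n)
            · rw [disjoint_iUnion₂_left]
              intro i hi
              exact hd (Finset.mem_range.1 hi).ne
          refine this _ _ ?_
          rw [Finset.range_add_one, Finset.set_biUnion_insert, union_comm]
      let i1 := sigmaWeak (Lp ℂ 2 (μ.prod ν)) (Lp ℂ 2 (μ.prod ν))
      refine IsClosed.mem_of_tendsto hD (tendsto_sw_of_bdd (l := atTop)
        (f := fun n => mE (⋃ i ∈ Finset.range n, f i) (hmu n)) 1 (fun n => mE_norm _ _) ?_)
        (Eventually.of_forall fin)
      intro x y
      simp only [inner_mE]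
      have hU : (⋃ i, f i) = ⋃ n, ⋃ i ∈ Finset.range n, f i := by
        ext z; simp only [mem_iUnion, Finset.mem_range]
        constructor
        · rintro ⟨i, hi⟩; exact ⟨i + 1, i, by omega, hi⟩
        · rintro ⟨_, i, _, hi⟩; exact ⟨i, hi⟩
      rw [hU]
      refine tendsto_setIntegral_of_monotone hmu ?_ ?_
      · intro a b hab
        exact biUnion_subset_biUnion_left (by simpa using hab)
      · exact (L2.integrable_inner y x).integrableOn
  induction φ using SimpleFunc.induction with
  | const c hs =>
    rename_i s
    have : mulS (μ := μ.prod ν) (SimpleFunc.piecewise s hs (SimpleFunc.const _ c)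
        (SimpleFunc.const _ 0)) = c • mE s hs := by
      ext1 f
      apply Lp.ext
      rw [smul_apply]
      filter_upwards [mulS_coe (SimpleFunc.piecewise s hs (SimpleFunc.const _ c)
        (SimpleFunc.const _ 0)) f, mE_coe s hs f, Lp.coeFn_smul c (mE s hs f)] with x h1 h2 h3
      rw [h1, h3, Pi.smul_apply, h2]
      by_cases h : x ∈ s <;> simp [h]
    rw [this]
    exact D.smul_mem _ (key s hs)
  | add hd h1 h2 => rw [mulS_add]; exact D.add_mem h1 h2

end Mult
end OpSynth


set_option linter.unusedSectionVars false
namespace OpSynth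
open Filter Topology

noncomputable section Mult2
variable {X₁ X₂ Y₁ Y₂ : Type*} [MeasurableSpace X₁] [MeasurableSpace X₂]
  [MeasurableSpace Y₁] [MeasurableSpace Y₂]
  {μ₁ : Measure X₁} {μ₂ : Measure X₂} {ν₁ : Measure Y₁} {ν₂ : Measure Y₂}
  [SigmaFinite μ₁] [SigmaFinite μ₂] [SigmaFinite ν₁] [SigmaFinite ν₂]

/-- `S` vanishes on the rectangle -/
def Kills (S : Lp ℂ 2 μ₁ →L[ℂ] Lp ℂ 2 μ₂) (α : Set X₁) (β : Set X₂) : Prop :=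
  ∀ (f : Lp ℂ 2 μ₁) (g : Lp ℂ 2 μ₂),
      (∀ᵐ x ∂μ₁, x ∉ α → f x = 0) → (∀ᵐ y ∂μ₂, y ∉ β → g y = 0) → ⟪S f, g⟫ = (0 : ℂ)

theorem kills_iff {S : Lp ℂ 2 μ₁ →L[ℂ] Lp ℂ 2 μ₂} {α : Set X₁} {β : Set X₂}
    (hα : MeasurableSet α) (hβ : MeasurableSet β) :
    Kills S α β ↔ mE β hβ ∘L S ∘L mE α hα = 0 := by
  constructor
  · intro h
    ext1 f
    refine ext_inner_right ℂ fun g => ?_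
    simp only [ContinuousLinearMap.comp_apply, zero_apply, inner_zero_left]
    rw [mE_inner]
    exact h _ _ (mE_vanish _ _ _) (mE_vanish _ _ _)
  · intro h f g hf hg
    rw [← mE_fix hα hf, ← mE_fix hβ hg, ← mE_inner]
    have := congrArg (fun A => A f) h
    simp only [ContinuousLinearMap.comp_apply, zero_apply] at this
    rw [this, inner_zero_left]

theorem mE_tensor {t : Lp ℂ 2 μ₁ → Lp ℂ 2 ν₁ → Lp ℂ 2 (μ₁.prod ν₁)}
    (ht' : ∀ f g, ⇑(t f g) =ᵐ[μ₁.prod ν₁] fun p : X₁ × Y₁ => f p.1 * g p.2)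
    {P : Set X₁} {Q : Set Y₁} (hP : MeasurableSet P) (hQ : MeasurableSet Q)
    (f : Lp ℂ 2 μ₁) (g : Lp ℂ 2 ν₁) :
    mE (P ×ˢ Q) (hP.prod hQ) (t f g) = t (mE P hP f) (mE Q hQ g) := by
  apply Lp.ext
  filter_upwards [mE_coe (P ×ˢ Q) (hP.prod hQ) (t f g), ht' f g, ht' (mE P hP f) (mE Q hQ g),
    Measure.quasiMeasurePreserving_fst.ae (mE_coe P hP f),
    Measure.quasiMeasurePreserving_snd.ae (mE_coe Q hQ g)] with x h1 h2 h3 h4 h5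
  rw [h1, h3, h4, h5]
  by_cases hp : x.1 ∈ P <;> by_cases hq : x.2 ∈ Q <;> simp [indicator, hp, hq, h2]

theorem mE_univ : mE (μ := μ₁) univ MeasurableSet.univ = 1 := by
  ext1 f
  exact mE_fix _ (Eventually.of_forall fun x hx => absurd (mem_univ x) hx)

theorem huu {A B : Type*} [MeasurableSpace A] [MeasurableSpace B] (m : Measure (A × B)) :
    mE (μ := m) (univ ×ˢ univ) (MeasurableSet.univ.prod MeasurableSet.univ) = 1 := by
  ext1 f
  exact mE_fix _ (Eventually.of_forall fun x hx => absurd (by simp) hx)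

theorem wT_mul {t₁ : Lp ℂ 2 μ₁ → Lp ℂ 2 ν₁ → Lp ℂ 2 (μ₁.prod ν₁)}
    {t₂ : Lp ℂ 2 μ₂ → Lp ℂ 2 ν₂ → Lp ℂ 2 (μ₂.prod ν₂)}
    (ht₁' : ∀ f g, ⇑(t₁ f g) =ᵐ[μ₁.prod ν₁] fun p : X₁ × Y₁ => f p.1 * g p.2)
    (ht₂' : ∀ f g, ⇑(t₂ f g) =ᵐ[μ₂.prod ν₂] fun p : X₂ × Y₂ => f p.1 * g p.2)
    {U : Set (Lp ℂ 2 μ₁ →L[ℂ] Lp ℂ 2 μ₂)} {V : Set (Lp ℂ 2 ν₁ →L[ℂ] Lp ℂ 2 ν₂)}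
    (hU : ∀ S ∈ U, ∀ α β (hα : MeasurableSet α) (hβ : MeasurableSet β), mE β hβ ∘L S ∘L mE α hα ∈ U)
    (hV : ∀ S ∈ V, ∀ α β (hα : MeasurableSet α) (hβ : MeasurableSet β), mE β hβ ∘L S ∘L mE α hα ∈ V)
    (φ : SimpleFunc (X₁ × Y₁) ℂ) (ψ : SimpleFunc (X₂ × Y₂) ℂ)
    (S : Lp ℂ 2 (μ₁.prod ν₁) →L[ℂ] Lp ℂ 2 (μ₂.prod ν₂)) (hS : S ∈ wTensor t₁ t₂ U V) :
    mulS ψ ∘L S ∘L mulS φ ∈ wTensor t₁ t₂ U V := by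
  set G : Set (Lp ℂ 2 (μ₁.prod ν₁) →L[ℂ] Lp ℂ 2 (μ₂.prod ν₂)) :=
    { W | ∃ S ∈ U, ∃ R ∈ V, IsElemTensor t₁ t₂ W S R } with hG
  have h0 : ∀ P Q P' Q' (hP : MeasurableSet P) (hQ : MeasurableSet Q) (hP' : MeasurableSet P')
      (hQ' : MeasurableSet Q'), ∀ S ∈ wSub (Submodule.span ℂ G),
      mE (P' ×ˢ Q') (hP'.prod hQ') ∘L S ∘L mE (P ×ˢ Q) (hP.prod hQ) ∈ wSub (Submodule.span ℂ G) := by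
    intro P Q P' Q' hP hQ hP' hQ'
    refine comp_mem_span _ _ ?_
    rintro W ⟨S, hS, R, hR, hW⟩
    refine le_wSub _ (Submodule.subset_span ⟨_, hU S hS P P' hP hP', _, hV R hR Q Q' hQ hQ', ?_⟩)
    intro x y
    simp only [ContinuousLinearMap.comp_apply]
    rw [mE_tensor ht₁' hP hQ, hW, mE_tensor ht₂' hP' hQ']
  have h1 : ∀ S ∈ wSub (Submodule.span ℂ G), S ∘L mulS φ ∈ wSub (Submodule.span ℂ G) := by
    intro S hS
    let D : Submodule ℂ (Lp ℂ 2 (μ₁.prod ν₁) →L[ℂ] Lp ℂ 2 (μ₁.prod ν₁)) :=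
      { carrier := {M | S ∘L M ∈ wSub (Submodule.span ℂ G)}
        add_mem' := by
          intro a b ha hb
          have : S ∘L (a + b) = S ∘L a + S ∘L b := by ext1; simp
          show S ∘L (a + b) ∈ wSub (Submodule.span ℂ G)
          rw [this]; exact add_mem ha hb
        zero_mem' := by
          show S ∘L 0 ∈ wSub (Submodule.span ℂ G)
          rw [ContinuousLinearMap.comp_zero]; exact zero_mem _
        smul_mem' := by
          intro c a ha
          have : S ∘L (c • a) = c • (S ∘L a) := by ext1; simp
          show S ∘L (c • a) ∈ wSub (Submodule.span ℂ G)
          rw [this]; exact Submodule.smul_mem _ _ ha }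
    refine pi_lambda D ?_ hS ?_ φ
    · let i1 := sigmaWeak (Lp ℂ 2 (μ₁.prod ν₁)) (Lp ℂ 2 (μ₂.prod ν₂))
      let i2 := sigmaWeak (Lp ℂ 2 (μ₁.prod ν₁)) (Lp ℂ 2 (μ₁.prod ν₁))
      exact IsClosed.preimage (comp_cont 1 S) (wSub_closed (Submodule.span ℂ G))
    · intro P Q hP hQ
      have := h0 P Q univ univ hP hQ .univ .univ S hS
      rw [huu] at this
      exact this
  have h2 : ∀ S ∈ wSub (Submodule.span ℂ G), mulS ψ ∘L S ∈ wSub (Submodule.span ℂ G) := by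
    intro S hS
    let D : Submodule ℂ (Lp ℂ 2 (μ₂.prod ν₂) →L[ℂ] Lp ℂ 2 (μ₂.prod ν₂)) :=
      { carrier := {M | M ∘L S ∈ wSub (Submodule.span ℂ G)}
        add_mem' := by
          intro a b ha hb
          have : (a + b) ∘L S = a ∘L S + b ∘L S := by ext1; simp
          show (a + b) ∘L S ∈ wSub (Submodule.span ℂ G)
          rw [this]; exact add_mem ha hb
        zero_mem' := by
          show 0 ∘L S ∈ wSub (Submodule.span ℂ G)
          rw [ContinuousLinearMap.zero_comp]; exact zero_mem _
        smul_mem' := by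
          intro c a ha
          have : (c • a) ∘L S = c • (a ∘L S) := by ext1; simp
          show (c • a) ∘L S ∈ wSub (Submodule.span ℂ G)
          rw [this]; exact Submodule.smul_mem _ _ ha }
    refine pi_lambda D ?_ hS ?_ ψ
    · let i1 := sigmaWeak (Lp ℂ 2 (μ₁.prod ν₁)) (Lp ℂ 2 (μ₂.prod ν₂))
      let i2 := sigmaWeak (Lp ℂ 2 (μ₂.prod ν₂)) (Lp ℂ 2 (μ₂.prod ν₂))
      exact IsClosed.preimage (comp_cont S 1) (wSub_closed (Submodule.span ℂ G))
    · intro P Q hP hQ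
      have := h0 univ univ P Q .univ .univ hP hQ S hS
      rw [huu] at this
      exact this
  exact h2 _ (h1 S hS)

theorem kills_left {t₁ : Lp ℂ 2 μ₁ → Lp ℂ 2 ν₁ → Lp ℂ 2 (μ₁.prod ν₁)}
    {t₂ : Lp ℂ 2 μ₂ → Lp ℂ 2 ν₂ → Lp ℂ 2 (μ₂.prod ν₂)}
    (ht₁ : IsTensorEmbedding t₁) (ht₂ : IsTensorEmbedding t₂)
    (ht₁' : ∀ f g, ⇑(t₁ f g) =ᵐ[μ₁.prod ν₁] fun p : X₁ × Y₁ => f p.1 * g p.2)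
    (ht₂' : ∀ f g, ⇑(t₂ f g) =ᵐ[μ₂.prod ν₂] fun p : X₂ × Y₂ => f p.1 * g p.2)
    {U : Set (Lp ℂ 2 μ₁ →L[ℂ] Lp ℂ 2 μ₂)} {V : Set (Lp ℂ 2 ν₁ →L[ℂ] Lp ℂ 2 ν₂)}
    {α : Set X₁} {β : Set X₂} {γ : Set Y₁} {δ : Set Y₂}
    (hα : MeasurableSet α) (hβ : MeasurableSet β) (hγ : MeasurableSet γ) (hδ : MeasurableSet δ)
    (h : (∀ S ∈ U, Kills S α β) ∨ (∀ S ∈ V, Kills S γ δ))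
    {S : Lp ℂ 2 (μ₁.prod ν₁) →L[ℂ] Lp ℂ 2 (μ₂.prod ν₂)} (hS : S ∈ wTensor t₁ t₂ U V) :
    Kills S (α ×ˢ γ) (β ×ˢ δ) := by
  intro F G hF hG
  rw [← inner_conj_symm]
  have : vf F G S = 0 := by
    rw [wTensor, mem_wkClosure_iff] at hS
    refine hS _ (vf_mem F G) ?_
    intro W hW
    induction hW using Submodule.span_induction with
    | mem W hW =>
      obtain ⟨S, hS, R, hR, hW⟩ := hW
      have hk : Kills W (α ×ˢ γ) (β ×ˢ δ) := by
        rw [kills_iff (hα.prod hγ) (hβ.prod hδ)]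
        refine ht₁.ext fun x y => ?_
        simp only [ContinuousLinearMap.comp_apply]
        rw [mE_tensor ht₁' hα hγ, hW, mE_tensor ht₂' hβ hδ, zero_apply]
        rcases h with h | h
        · have h3 := congrArg (fun A => A x) ((kills_iff hα hβ).1 (h S hS))
          simp only [ContinuousLinearMap.comp_apply, zero_apply] at h3
          rw [h3]
          exact map_zero (Jop ht₂ _)
        · have h3 := congrArg (fun A => A y) ((kills_iff hγ hδ).1 (h R hR))
          simp only [ContinuousLinearMap.comp_apply, zero_apply] at h3
          rw [h3]
          exact map_zero (Jop ht₂.swap _)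
      exact inner_eq_zero_symm.1 (hk F G hF hG)
    | zero => simp [vf]
    | add a b _ _ ha hb => rw [(pre_isLinear (vf_mem F G)).map_add, ha, hb, add_zero]
    | smul c a _ ha => rw [(pre_isLinear (vf_mem F G)).map_smul, ha, smul_zero]
  show starRingEnd ℂ (vf F G S) = 0
  rw [this, map_zero]

end Mult2
end OpSynth


set_option linter.unusedSectionVars false
namespace OpSynth
open Filter Topology

noncomputable section Ksec
variable {H K : Type*}
  [NormedAddCommGroup H] [InnerProductSpace ℂ H]
  [NormedAddCommGroup K] [InnerProductSpace ℂ K]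

theorem cs_op' {J : Type*} {ξ : J → H} {η : J → K} {R Q : ℝ} (hξ : Summable fun n => ‖ξ n‖ ^ 2)
    (hη : Summable fun n => ‖η n‖ ^ 2) (hR : 0 ≤ R) (hQ : 0 ≤ Q)
    (h1 : ∑' n, ‖ξ n‖ ^ 2 ≤ R ^ 2) (h2 : ∑' n, ‖η n‖ ^ 2 ≤ Q ^ 2) (T : H →L[ℂ] K) :
    ‖∑' n, ⟪η n, T (ξ n)⟫‖ ≤ ‖T‖ * (R * Q) := by
  refine (cs_op hξ hη T).2.trans ?_
  have := Real.sqrt_le_sqrt h1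
  have := Real.sqrt_le_sqrt h2
  rw [Real.sqrt_sq hR] at *
  rw [Real.sqrt_sq hQ] at *
  gcongr

theorem e1 {J : Type*} {v w : J → ℂ} {a : J → H} {b : J → K} {f : H} {g : K} {S : H →L[ℂ] K}
    {V W r F G : ℝ} (hv : Summable fun n => ‖v n‖ ^ 2) (hw : Summable fun n => ‖w n‖ ^ 2)
    (ha : Summable fun n => ‖a n‖ ^ 2) (hb : Summable fun n => ‖b n‖ ^ 2)
    (hV0 : 0 ≤ V) (hW0 : 0 ≤ W) (hr : 0 ≤ r) (hV : ∑' n, ‖v n‖ ^ 2 ≤ V ^ 2)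
    (hW : ∑' n, ‖w n‖ ^ 2 ≤ W ^ 2) (hF : ‖f‖ ≤ F) (hG : ‖g‖ ≤ G)
    (hA : ∑' n, ‖a n‖ ^ 2 ≤ (r * F) ^ 2) (hB : ∑' n, ‖b n‖ ^ 2 ≤ (r * G) ^ 2)
    (h : ∑' n, ⟪w n • g + b n, S (v n • f + a n)⟫ = 0) :
    ‖∑' n, v n * (starRingEnd ℂ) (w n)‖ * ‖⟪g, S f⟫‖ ≤
      ‖S‖ * (F * G) * (r * (V + W) + r ^ 2) := by
  have hF0 : 0 ≤ F := (norm_nonneg _).trans hF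
  have hG0 : 0 ≤ G := (norm_nonneg _).trans hG
  have hvf : Summable fun n => ‖v n • f‖ ^ 2 := by
    simp only [norm_smul, mul_pow]; exact hv.mul_right _
  have hwg : Summable fun n => ‖w n • g‖ ^ 2 := by
    simp only [norm_smul, mul_pow]; exact hw.mul_right _
  have hvf' : ∑' n, ‖v n • f‖ ^ 2 ≤ (V * F) ^ 2 := by
    simp only [norm_smul, mul_pow]; rw [tsum_mul_right]
    gcongr
  have hwg' : ∑' n, ‖w n • g‖ ^ 2 ≤ (W * G) ^ 2 := by
    simp only [norm_smul, mul_pow]; rw [tsum_mul_right]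
    gcongr
  have s0 := cs_summable hvf hwg S
  have s1 := cs_summable ha hwg S
  have s2 := cs_summable hvf hb S
  have s3 := cs_summable ha hb S
  have e : ∑' n, ⟪w n • g + b n, S (v n • f + a n)⟫ = ∑' n, ⟪w n • g, S (v n • f)⟫ +
      ∑' n, ⟪w n • g, S (a n)⟫ + (∑' n, ⟪b n, S (v n • f)⟫ + ∑' n, ⟪b n, S (a n)⟫) := by
    rw [← s0.tsum_add s1, ← s2.tsum_add s3, ← (s0.add s1).tsum_add (s2.add s3)]
    congr 1; ext n
    simp only [map_add, inner_add_left, inner_add_right]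
    ring
  have e0 : ∑' n, ⟪w n • g, S (v n • f)⟫ = (∑' n, v n * (starRingEnd ℂ) (w n)) * ⟪g, S f⟫ := by
    rw [← tsum_mul_right]
    congr 1; ext n
    rw [map_smul, inner_smul_left, inner_smul_right]; ring
  rw [h, e0] at e
  rw [← norm_mul]
  have b1 := cs_op' ha hwg (by positivity) (by positivity) hA hwg' S
  have b2 := cs_op' hvf hb (by positivity) (by positivity) hvf' hB S
  have b3 := cs_op' ha hb (by positivity) (by positivity) hA hB S
  have e' : (∑' n, v n * (starRingEnd ℂ) (w n)) * ⟪g, S f⟫ = -(∑' n, ⟪w n • g, S (a n)⟫ +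
      (∑' n, ⟪b n, S (v n • f)⟫ + ∑' n, ⟪b n, S (a n)⟫)) := by linear_combination -e
  rw [e', norm_neg]
  refine (norm_add_le _ _).trans ((add_le_add_right (norm_add_le _ _) _).trans ?_)
  refine (add_le_add b1 (add_le_add b2 b3)).trans (le_of_eq ?_)
  ring

instance lp_sep (J : Type*) [Countable J] :
    TopologicalSpace.SeparableSpace (lp (fun _ : J => ℂ) 2) := by
  classical
  have hs : TopologicalSpace.IsSeparable (closure (Submodule.span ℂ
      (range fun j : J => lp.single (E := fun _ : J => ℂ) 2 j (1 : ℂ)) : Set (lp (fun _ : J => ℂ) 2))) :=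
    ((countable_range _).isSeparable.span (R := ℂ)).closure
  rw [← TopologicalSpace.isSeparable_univ_iff]
  refine hs.mono fun f _ => ?_
  have h1 := lp.hasSum_single (E := fun _ : J => ℂ) (p := 2) (by simp) f
  refine mem_closure_of_tendsto h1 (Eventually.of_forall fun s => ?_)
  refine Submodule.sum_mem _ fun j _ => ?_
  have : lp.single (E := fun _ : J => ℂ) 2 j (f j) = (f j) • lp.single (E := fun _ : J => ℂ) 2 j (1 : ℂ) := by
    rw [← lp.single_smul]; simp
  rw [this]
  exact Submodule.smul_mem _ _ (Submodule.subset_span ⟨j, rfl⟩)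

theorem lp_sq {J : Type*} (v : lp (fun _ : J => ℂ) 2) :
    HasSum (fun n => ‖v n‖ ^ 2) (‖v‖ ^ 2) := by
  have := lp.hasSum_norm (p := 2) (by simp) v
  simpa using this

def toL {J : Type*} (a : J → ℂ) (h : Summable fun n => ‖a n‖ ^ 2) : lp (fun _ : J => ℂ) 2 :=
  ⟨a, by show Memℓp a 2; rw [memℓp_gen_iff (by simp)]; simpa using h⟩

end Ksec
end OpSynth


set_option linter.unusedSectionVars false
namespace OpSynth
open Filter Topology

noncomputable section Ksec2
variable {X Y : Type*} [MeasurableSpace X] [MeasurableSpace Y] {μ : Measure X} {ν : Measure Y} [SigmaFinite μ] [SigmaFinite ν]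

theorem enorm_sq (f : Lp ℂ 2 μ) : ‖f‖ₑ ^ 2 = ∫⁻ x, ‖f x‖ₑ ^ 2 ∂μ := by
  rw [Lp.enorm_def]
  have := eLpNorm_nnreal_pow_eq_lintegral (f := f) (μ := μ) (p := 2) (by simp)
  simpa using this

/-- the set of points where the fibre is close to `v` -/
def near {J : Type*} (ξ : J → Lp ℂ 2 μ) (v : J → ℂ) (r : ℝ) : Set X :=
  {x | ∑' n, ‖ξ n x - v n‖ₑ ^ 2 < ENNReal.ofReal (r ^ 2)}

theorem near_meas {J : Type*} [Countable J] (ξ : J → Lp ℂ 2 μ) (v : J → ℂ) (r : ℝ) :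
    MeasurableSet (near ξ v r) := by
  refine measurableSet_lt (Measurable.ennreal_tsum fun n => ?_) measurable_const
  exact (((Lp.stronglyMeasurable (ξ n)).measurable.sub measurable_const).enorm).pow_const 2

theorem near_bound {J : Type*} [Countable J] (ξ : J → Lp ℂ 2 μ) (v : J → ℂ) {r : ℝ} (hr : 0 ≤ r)
    (f : Lp ℂ 2 μ) (φ : SimpleFunc X ℂ) (hf : ⇑f =ᵐ[μ] φ) :
    (Summable fun n => ‖mE _ (near_meas ξ v r) (mulS φ (ξ n)) - v n • mE _ (near_meas ξ v r) f‖ ^ 2)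
    ∧ ∑' n, ‖mE _ (near_meas ξ v r) (mulS φ (ξ n)) - v n • mE _ (near_meas ξ v r) f‖ ^ 2
      ≤ (r * ‖f‖) ^ 2 := by
  set a := fun n => mE _ (near_meas ξ v r) (mulS φ (ξ n)) - v n • mE _ (near_meas ξ v r) f with ha
  have key : ∑' n, ‖a n‖ₑ ^ 2 ≤ ENNReal.ofReal ((r * ‖f‖) ^ 2) := by
    simp only [enorm_sq]
    rw [← lintegral_tsum fun n => ((Lp.stronglyMeasurable (a n)).measurable.enorm.pow_const 2).aemeasurable]
    have h2 : ENNReal.ofReal ((r * ‖f‖) ^ 2) = ENNReal.ofReal (r ^ 2) * ∫⁻ x, ‖f x‖ₑ ^ 2 ∂μ := by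
      rw [← enorm_sq, mul_pow, ENNReal.ofReal_mul (by positivity), ENNReal.ofReal_pow (norm_nonneg _),
        ofReal_norm]
    rw [h2, ← lintegral_const_mul _ ((Lp.stronglyMeasurable f).measurable.enorm.pow_const 2)]
    refine lintegral_mono_ae ?_
    have h3 : ∀ᵐ x ∂μ, ∀ n, a n x = (near ξ v r).indicator (fun x => φ x * (ξ n x - v n)) x := by
      rw [ae_all_iff]
      intro n
      filter_upwards [hf, Lp.coeFn_sub (mE _ (near_meas ξ v r) (mulS φ (ξ n)))
        (v n • mE _ (near_meas ξ v r) f), mE_coe _ (near_meas ξ v r) (mulS φ (ξ n)),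
        Lp.coeFn_smul (v n) (mE _ (near_meas ξ v r) f), mE_coe _ (near_meas ξ v r) f,
        mulS_coe φ (ξ n)] with x h1 h2 h3 h4 h5 h6
      rw [ha]
      simp only
      rw [h2, Pi.sub_apply, h3, h4, Pi.smul_apply, h5]
      by_cases hx : x ∈ near ξ v r
      · simp only [indicator_of_mem hx, smul_eq_mul]
        rw [h6, h1]; ring
      · simp [indicator_of_notMem hx]
    filter_upwards [h3, hf] with x hx h1
    simp only [hx]
    by_cases hx' : x ∈ near ξ v r
    · simp only [indicator_of_mem hx', enorm_mul, mul_pow]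
      rw [ENNReal.tsum_mul_left, mul_comm, h1]
      gcongr
      exact hx'.le
    · simp [indicator_of_notMem hx']
  have hs : ∑' n, ENNReal.ofReal (‖a n‖ ^ 2) ≤ ENNReal.ofReal ((r * ‖f‖) ^ 2) := by
    convert key using 3 with n
    rw [ENNReal.ofReal_pow (norm_nonneg _), ofReal_norm]
  have hsum : Summable fun n => ‖a n‖ ^ 2 := by
    have : Summable fun n => (ENNReal.ofReal (‖a n‖ ^ 2)).toReal :=
      ENNReal.summable_toReal (ne_top_of_le_ne_top ENNReal.ofReal_ne_top hs)
    simpa using this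
  refine ⟨hsum, ?_⟩
  rw [← ENNReal.ofReal_tsum_of_nonneg (fun n => by positivity) hsum] at hs
  exact (ENNReal.ofReal_le_ofReal_iff (by positivity)).1 hs

theorem near_kill {J : Type*} [Countable J] {W : Set (Lp ℂ 2 μ →L[ℂ] Lp ℂ 2 ν)}
    (hW : ∀ φ ψ, ∀ S ∈ W, mulS ψ ∘L S ∘L mulS φ ∈ W) {ξ : J → Lp ℂ 2 μ} {η : J → Lp ℂ 2 ν}
    (h : ∀ S ∈ W, ∑' n, ⟪η n, S (ξ n)⟫ = 0) (v w : lp (fun _ : J => ℂ) 2) {r : ℝ} (hr : 0 ≤ r)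
    (hd : r * (‖v‖ + ‖w‖) + r ^ 2 < ‖⟪w, v⟫‖) (S) (hS : S ∈ W) :
    Kills S (near ξ v r) (near η w r) := by
  have hα := near_meas ξ v r
  have hβ := near_meas η w r
  rw [kills_iff hα hβ]
  set S' := mE _ hβ ∘L S ∘L mE _ hα with hS'
  have hS'W : S' ∈ W := hW (indS _ hα) (indS _ hβ) S hS
  have idα : ∀ f : Lp ℂ 2 μ, mE _ hα (mE _ hα f) = mE _ hα f := fun f => mE_fix hα (mE_vanish _ hα f)
  have idβ : ∀ f : Lp ℂ 2 ν, mE _ hβ (mE _ hβ f) = mE _ hβ f := fun f => mE_fix hβ (mE_vanish _ hβ f)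
  set δ := r * (‖v‖ + ‖w‖) + r ^ 2 with hδ
  set d := ‖⟪w, v⟫‖ with hdd
  have hδ0 : 0 ≤ δ := by positivity
  have hdpos : 0 < d := hδ0.trans_lt hd
  have hvw : ∑' n, v n * (starRingEnd ℂ) (w n) = ⟪w, v⟫ := by
    rw [lp.inner_eq_tsum]; rfl
  have simp_bound : ∀ (f : Lp.simpleFunc ℂ 2 μ) (g : Lp.simpleFunc ℂ 2 ν),
      d * ‖⟪(g : Lp ℂ 2 ν), S' (f : Lp ℂ 2 μ)⟫‖ ≤ ‖S'‖ * (‖(f : Lp ℂ 2 μ)‖ * ‖(g : Lp ℂ 2 ν)‖) * δ := by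
    intro f g
    set φ := Lp.simpleFunc.toSimpleFunc f
    set ψ := Lp.simpleFunc.toSimpleFunc g
    have hf : ⇑(f : Lp ℂ 2 μ) =ᵐ[μ] φ := (Lp.simpleFunc.toSimpleFunc_eq_toFun f).symm
    have hg : ⇑(g : Lp ℂ 2 ν) =ᵐ[ν] ψ := (Lp.simpleFunc.toSimpleFunc_eq_toFun g).symm
    obtain ⟨a1, a2⟩ := near_bound ξ v hr f φ hf
    obtain ⟨b1, b2⟩ := near_bound η w hr g ψ hg
    have nf : ‖mE _ hα (f : Lp ℂ 2 μ)‖ ≤ ‖(f : Lp ℂ 2 μ)‖ := by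
      simpa using (mE _ hα).le_of_opNorm_le (mE_norm _ hα) (f : Lp ℂ 2 μ)
    have ng : ‖mE _ hβ (g : Lp ℂ 2 ν)‖ ≤ ‖(g : Lp ℂ 2 ν)‖ := by
      simpa using (mE _ hβ).le_of_opNorm_le (mE_norm _ hβ) (g : Lp ℂ 2 ν)
    have := e1 (S := S') (lp_sq v).summable (lp_sq w).summable a1 b1 (norm_nonneg v) (norm_nonneg w) hr
      (lp_sq v).tsum_eq.le (lp_sq w).tsum_eq.le nf ng a2 b2 (by
        simp only [add_sub_cancel]
        have h0 := h _ (hW φ (ψ.map (starRingEnd ℂ)) _ (hW (indS _ hα) (indS _ hβ) _ hS'W))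
        rw [← h0]
        congr 1; ext n
        simp only [ContinuousLinearMap.comp_apply]
        rw [← mulS_inner]
        exact mE_inner _ hβ _ _)
    rw [hvw] at this
    convert this using 3
    rw [mE_inner, hS']
    simp only [ContinuousLinearMap.comp_apply, idα, idβ]
  have bound : ∀ (f : Lp ℂ 2 μ) (g : Lp ℂ 2 ν),
      d * ‖⟪g, S' f⟫‖ ≤ ‖S'‖ * (‖f‖ * ‖g‖) * δ := by
    intro f g
    have hc : IsClosed {p : Lp ℂ 2 μ × Lp ℂ 2 ν | d * ‖⟪p.2, S' p.1⟫‖ ≤ ‖S'‖ * (‖p.1‖ * ‖p.2‖) * δ} :=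
      isClosed_le (by fun_prop) (by fun_prop)
    have hdense : DenseRange (Prod.map ((↑) : Lp.simpleFunc ℂ 2 μ → Lp ℂ 2 μ)
        ((↑) : Lp.simpleFunc ℂ 2 ν → Lp ℂ 2 ν)) :=
      (Lp.simpleFunc.denseRange (by simp)).prodMap (Lp.simpleFunc.denseRange (by simp))
    have := hdense.induction_on (p := fun p => d * ‖⟪p.2, S' p.1⟫‖ ≤ ‖S'‖ * (‖p.1‖ * ‖p.2‖) * δ) (f, g) hc
      (fun q => simp_bound q.1 q.2)
    exact this
  have hn : ‖S'‖ ≤ ‖S'‖ * (δ / d) := by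
    refine S'.opNorm_le_bound (by positivity) fun f => ?_
    have := bound f (S' f)
    rw [inner_self_eq_norm_sq_to_K] at this
    have h5 : d * ‖S' f‖ ^ 2 ≤ ‖S'‖ * (‖f‖ * ‖S' f‖) * δ := by simpa using this
    rcases (norm_nonneg (S' f)).eq_or_lt with h0 | h0
    · rw [← h0]; positivity
    · rw [mul_div_assoc', div_mul_eq_mul_div, le_div_iff₀ hdpos]
      nlinarith
  by_contra hne
  have hp : 0 < ‖S'‖ := norm_pos_iff.2 hne
  have : δ / d < 1 := (div_lt_one hdpos).2 hd
  nlinarith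

theorem lemK {J : Type*} [Countable J] {W : Set (Lp ℂ 2 μ →L[ℂ] Lp ℂ 2 ν)}
    (hW : ∀ φ ψ, ∀ S ∈ W, mulS ψ ∘L S ∘L mulS φ ∈ W) {ξ : J → Lp ℂ 2 μ} {η : J → Lp ℂ 2 ν}
    (h : ∀ S ∈ W, ∑' n, ⟪η n, S (ξ n)⟫ = 0) :
    ∃ (α : ℕ × ℕ × ℕ → Set X) (β : ℕ × ℕ × ℕ → Set Y), (∀ i, MeasurableSet (α i)) ∧
      (∀ i, MeasurableSet (β i)) ∧ (∀ i, ∀ S ∈ W, Kills S (α i) (β i)) ∧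
      ∀ x y, (Summable fun n => ‖ξ n x‖ ^ 2) → (Summable fun n => ‖η n y‖ ^ 2) →
        ∑' n, ⟪η n y, ξ n x⟫ ≠ 0 → ∃ i, x ∈ α i ∧ y ∈ β i := by
  classical
  let D : ℕ → lp (fun _ : J => ℂ) 2 := TopologicalSpace.denseSeq _
  have hD : DenseRange D := TopologicalSpace.denseRange_denseSeq _
  let r : ℕ → ℝ := fun m => 1 / ((m : ℝ) + 1)
  have hr : ∀ m, 0 < r m := fun m => by positivity
  let C : ℕ × ℕ × ℕ → Prop := fun i => r i.2.2 * (‖D i.1‖ + ‖D i.2.1‖) + r i.2.2 ^ 2 < ‖⟪D i.2.1, D i.1⟫‖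
  refine ⟨fun i => if C i then near ξ (D i.1) (r i.2.2) else ∅, fun i => near η (D i.2.1) (r i.2.2),
    fun i => ?_, fun i => near_meas _ _ _, fun i S hS => ?_, ?_⟩
  · dsimp only; split_ifs
    exacts [near_meas _ _ _, MeasurableSet.empty]
  · dsimp only; split_ifs with hC
    · exact near_kill hW h _ _ (hr _).le hC S hS
    · intro f g hf _
      have : f = 0 := by
        refine Lp.ext ?_
        filter_upwards [hf, Lp.coeFn_zero ℂ 2 μ] with x hx h0
        rw [h0]; exact hx (by simp)
      simp [this]
  · intro x y hx hy hne
    set a := toL _ hx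
    set b := toL _ hy
    have hab : ⟪b, a⟫ ≠ 0 := by
      rw [lp.inner_eq_tsum]; exact hne
    set d := ‖⟪b, a⟫‖
    have hd : 0 < d := norm_pos_iff.2 hab
    set s := ‖a‖ + ‖b‖ with hs
    have hs0 : 0 ≤ s := by positivity
    obtain ⟨m, hm⟩ := exists_nat_one_div_lt (show 0 < min 1 (d / (2 * s + 6)) by positivity)
    have hm1 : r m < 1 := hm.trans_le (min_le_left _ _)
    have hm2 : r m * (2 * s + 6) < d := by
      rw [← lt_div_iff₀ (by positivity)]
      exact hm.trans_le (min_le_right _ _)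
    obtain ⟨i, hi⟩ := hD.exists_dist_lt a (hr m)
    obtain ⟨j, hj⟩ := hD.exists_dist_lt b (hr m)
    rw [dist_eq_norm] at hi hj
    have mem : ∀ (c u : lp (fun _ : J => ℂ) 2), ‖c - u‖ < r m →
        ∑' n, ‖c n - u n‖ₑ ^ 2 < ENNReal.ofReal (r m ^ 2) := by
      intro c u hcu
      have h1 := lp_sq (c - u)
      have h2 : ∑' n, ‖c n - u n‖ₑ ^ 2 = ENNReal.ofReal (‖c - u‖ ^ 2) := by
        rw [← h1.tsum_eq, ENNReal.ofReal_tsum_of_nonneg (fun n => by positivity) h1.summable]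
        congr 1; ext n
        rw [ENNReal.ofReal_pow (norm_nonneg _), ofReal_norm]; rfl
      rw [h2]
      exact (ENNReal.ofReal_lt_ofReal_iff (by have := hr m; positivity)).2 (by gcongr)
    have hC : C (i, j, m) := by
      show r m * (‖D i‖ + ‖D j‖) + r m ^ 2 < ‖⟪D j, D i⟫‖
      have n1 : ‖D i‖ ≤ ‖a‖ + r m := by
        have := norm_sub_norm_le (D i) a
        rw [norm_sub_rev] at this; linarith
      have n2 : ‖D j‖ ≤ ‖b‖ + r m := by
        have := norm_sub_norm_le (D j) b
        rw [norm_sub_rev] at this; linarith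
      have e : ⟪b, a⟫ = ⟪D j, D i⟫ + ⟪D j, a - D i⟫ + ⟪b - D j, a⟫ := by
        simp only [inner_sub_left, inner_sub_right]; ring
      have h1 : d ≤ ‖⟪D j, D i⟫‖ + ‖D j‖ * ‖a - D i‖ + ‖b - D j‖ * ‖a‖ := by
        show ‖⟪b, a⟫‖ ≤ _
        rw [e]
        refine (norm_add_le _ _).trans (add_le_add ((norm_add_le _ _).trans
          (add_le_add le_rfl (norm_inner_le_norm _ _))) (norm_inner_le_norm _ _))
      have h2 : ‖D j‖ * ‖a - D i‖ ≤ (‖b‖ + r m) * r m := by gcongr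
      have h3 : ‖b - D j‖ * ‖a‖ ≤ r m * ‖a‖ := by gcongr
      have h4 : r m * (‖D i‖ + ‖D j‖) ≤ r m * (‖a‖ + r m + (‖b‖ + r m)) := by
        have := hr m
        gcongr
      have h5 : r m * r m ≤ r m * 1 := by have := hr m; gcongr
      have h6 := hr m
      nlinarith
    refine ⟨(i, j, m), ?_, mem b (D j) hj⟩
    simp only [hC, if_true]
    exact mem a (D i) hi

end Ksec2
end OpSynth


set_option linter.unusedSectionVars false
namespace OpSynth
open Filter Topology

noncomputable section Fsec
variable {X Y : Type*} [MeasurableSpace X] [MeasurableSpace Y] {μ : Measure X} {ν : Measure Y} [SigmaFinite μ] [SigmaFinite ν]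

theorem kills_split {T : Lp ℂ 2 μ →L[ℂ] Lp ℂ 2 ν} {A : Set X} {B : Set Y} {E : Set X}
    (hE : MeasurableSet E) (h1 : Kills T (A ∩ E) B) (h2 : Kills T (A \ E) B) : Kills T A B := by
  intro f g hf hg
  have e : f = mE E hE f + mE Eᶜ hE.compl f := by rw [mE_compl _ hE]; simp
  rw [e, map_add, inner_add_left, h1 _ g _ hg, h2 _ g _ hg, add_zero]
  · filter_upwards [mE_vanish Eᶜ hE.compl f, hf, mE_coe _ hE.compl f] with x p1 p2 p3 hx
    by_cases hxE : x ∈ E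
    · exact p1 (by simpa using hxE)
    · rw [p3, indicator_of_mem (by simpa using hxE)]
      exact p2 fun hA => hx ⟨hA, hxE⟩
  · filter_upwards [mE_vanish E hE f, hf, mE_coe _ hE f] with x p1 p2 p3 hx
    by_cases hxE : x ∈ E
    · rw [p3, indicator_of_mem hxE]
      exact p2 fun hA => hx ⟨hA, hxE⟩
    · exact p1 hxE

theorem kills_split' {T : Lp ℂ 2 μ →L[ℂ] Lp ℂ 2 ν} {A : Set X} {B : Set Y} {E : Set Y}
    (hE : MeasurableSet E) (h1 : Kills T A (B ∩ E)) (h2 : Kills T A (B \ E)) : Kills T A B := by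
  intro f g hf hg
  have e : g = mE E hE g + mE Eᶜ hE.compl g := by rw [mE_compl _ hE]; simp
  rw [e, inner_add_right, h1 f _ hf, h2 f _ hf, add_zero]
  · filter_upwards [mE_vanish Eᶜ hE.compl g, hg, mE_coe _ hE.compl g] with x p1 p2 p3 hx
    by_cases hxE : x ∈ E
    · exact p1 (by simpa using hxE)
    · rw [p3, indicator_of_mem (by simpa using hxE)]
      exact p2 fun hA => hx ⟨hA, hxE⟩
  · filter_upwards [mE_vanish E hE g, hg, mE_coe _ hE g] with x p1 p2 p3 hx
    by_cases hxE : x ∈ E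
    · rw [p3, indicator_of_mem hxE]
      exact p2 fun hA => hx ⟨hA, hxE⟩
    · exact p1 hxE

theorem Kills.mono {T : Lp ℂ 2 μ →L[ℂ] Lp ℂ 2 ν} {A A' : Set X} {B B' : Set Y}
    (h : Kills T A B) (hA : A' ⊆ A) (hB : B' ⊆ B) : Kills T A' B' := by
  intro f g hf hg
  refine h f g ?_ ?_
  · filter_upwards [hf] with x hx h' using hx fun h2 => h' (hA h2)
  · filter_upwards [hg] with x hx h' using hx fun h2 => h' (hB h2)

theorem kills_empty (T : Lp ℂ 2 μ →L[ℂ] Lp ℂ 2 ν) (B : Set Y) : Kills T ∅ B := by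
  intro f g hf _
  have : f = 0 := by
    refine Lp.ext ?_
    filter_upwards [hf, Lp.coeFn_zero ℂ 2 μ] with x hx h0
    rw [h0]; exact hx (by simp)
  simp [this]

theorem kills_empty' (T : Lp ℂ 2 μ →L[ℂ] Lp ℂ 2 ν) (A : Set X) : Kills T A ∅ := by
  intro f g _ hf
  have : g = 0 := by
    refine Lp.ext ?_
    filter_upwards [hf, Lp.coeFn_zero ℂ 2 ν] with x hx h0
    rw [h0]; exact hx (by simp)
  simp [this]

theorem cover_fin {ι : Type*} {T : Lp ℂ 2 μ →L[ℂ] Lp ℂ 2 ν} {α : ι → Set X} {β : ι → Set Y}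
    (hα : ∀ i, MeasurableSet (α i)) (hβ : ∀ i, MeasurableSet (β i)) (hk : ∀ i, Kills T (α i) (β i))
    (s : Finset ι) : ∀ (A : Set X) (B : Set Y), A ×ˢ B ⊆ ⋃ i ∈ s, α i ×ˢ β i → Kills T A B := by
  classical
  induction s using Finset.induction_on with
  | empty =>
    intro A B h
    simp only [Finset.notMem_empty, iUnion_of_empty, iUnion_empty, subset_empty_iff,
      prod_eq_empty_iff] at h
    rcases h with rfl | rfl
    exacts [kills_empty _ _, kills_empty' _ _]
  | insert i s _ ih =>
    intro A B h
    have key : ∀ x ∈ A, ∀ y ∈ B, (x ∈ α i ∧ y ∈ β i) ∨ (x, y) ∈ ⋃ i ∈ s, α i ×ˢ β i := by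
      intro x hx y hy
      have := h (mk_mem_prod hx hy)
      rw [Finset.set_biUnion_insert] at this
      exact this
    refine kills_split (hα i) (kills_split' (hβ i) ?_ ?_) ?_
    · exact (hk i).mono inter_subset_right inter_subset_right
    · refine ih _ _ ?_
      rintro ⟨x, y⟩ ⟨hx, hy⟩
      exact (key x hx.1 y hy.1).resolve_left fun h => hy.2 h.2
    · refine ih _ _ ?_
      rintro ⟨x, y⟩ ⟨hx, hy⟩
      exact (key x hx.1 y hy).resolve_left fun h => hx.2 h.1

theorem top_open [StandardBorelSpace X] {ι : Type*} [Countable ι] {α : ι → Set X}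
    (hα : ∀ i, MeasurableSet (α i)) :
    ∃ _ : TopologicalSpace X, BorelSpace X ∧ PolishSpace X ∧ ∀ i, IsOpen (α i) := by
  classical
  letI := upgradeStandardBorel X
  have hm : Measurable (fun x (i : ι) => decide (x ∈ α i)) := by
    refine measurable_pi_lambda _ fun i => ?_
    refine measurable_to_bool ?_
    convert hα i using 1
    ext x; simp
  obtain ⟨t, hle, hc, ht⟩ := hm.exists_continuous
  refine ⟨t, ?_, ht, fun i => ?_⟩
  · constructor
    rw [eq_borel_upgradeStandardBorel X, borel_eq_borel_of_le ht _ hle]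
    infer_instance
  · have h1 : @Continuous _ _ t _ (fun x => decide (x ∈ α i)) :=
      (@continuous_pi_iff _ _ _ t _ _).1 hc i
    have := (isOpen_discrete ({true} : Set Bool)).preimage h1
    convert this using 1
    ext x; simp

theorem compact_approx [TopologicalSpace X] [BorelSpace X] [PolishSpace X] {A : Set X}
    (hA : MeasurableSet A) (f : Lp ℂ 2 μ) (hf : ∀ᵐ x ∂μ, x ∉ A → f x = 0) :
    ∃ K : ℕ → Set X, (∀ n, K n ⊆ A) ∧ (∀ n, IsCompact (K n)) ∧ ∃ hK : ∀ n, MeasurableSet (K n),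
      Tendsto (fun n => mE (K n) (hK n) f) atTop (𝓝 f) := by
  set m := μ.withDensity (fun x => ‖f x‖ₑ ^ 2) with hm
  have hfin : IsFiniteMeasure m := isFiniteMeasure_withDensity (by
    rw [← enorm_sq]; simp)
  have hmA : m Aᶜ = 0 := by
    rw [hm, withDensity_apply _ hA.compl, setLIntegral_eq_zero_iff hA.compl
      ((Lp.stronglyMeasurable f).measurable.enorm.pow_const 2)]
    filter_upwards [hf] with x hx h
    simp [hx h]
  have hreg := innerRegular_isCompact_isClosed_measurableSet_of_finite m
  have : ∀ n : ℕ, ∃ K ⊆ A, (IsCompact K ∧ IsClosed K) ∧ m A < m K + ((n : ENNReal) + 1)⁻¹ := fun n =>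
    hreg.exists_subset_lt_add ⟨isCompact_empty, isClosed_empty⟩ hA (measure_ne_top _ _) (by simp)
  choose K hKA hKc hKm using this
  refine ⟨K, hKA, fun n => (hKc n).1, fun n => (hKc n).2.measurableSet, ?_⟩
  rw [tendsto_iff_edist_tendsto_0]
  have hb : ∀ n, edist (mE (K n) (hKc n).2.measurableSet f) f ^ 2 ≤ ((n : ENNReal) + 1)⁻¹ := by
    intro n
    have hKn := (hKc n).2.measurableSet
    rw [edist_comm, edist_eq_enorm_sub, enorm_sq]
    have h1 : ∫⁻ x, ‖(f - mE (K n) hKn f : Lp ℂ 2 μ) x‖ₑ ^ 2 ∂μ = m (K n)ᶜ := by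
      rw [hm, withDensity_apply _ hKn.compl, ← lintegral_indicator hKn.compl]
      refine lintegral_congr_ae ?_
      filter_upwards [Lp.coeFn_sub f (mE (K n) hKn f), mE_coe _ hKn f] with x h1 h2
      rw [h1, Pi.sub_apply, h2]
      by_cases hx : x ∈ K n <;> simp [hx]
    rw [h1]
    have h2 : m (K n)ᶜ ≤ m (A \ K n) + m Aᶜ := by
      refine (measure_mono ?_).trans (measure_union_le _ _)
      intro x hx
      by_cases hxA : x ∈ A
      · exact Or.inl ⟨hxA, hx⟩
      · exact Or.inr hxA
    rw [hmA, add_zero] at h2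
    refine h2.trans ?_
    rw [measure_diff (hKA n) hKn.nullMeasurableSet (measure_ne_top _ _)]
    exact tsub_le_iff_left.2 (hKm n).le
  have h0 : Tendsto (fun n : ℕ => ((n : ENNReal) + 1)⁻¹) atTop (𝓝 0) := by
    have := (tendsto_add_atTop_iff_nat 1).2 ENNReal.tendsto_inv_nat_nhds_zero
    simpa using this
  have h1 := tendsto_of_tendsto_of_tendsto_of_le_of_le tendsto_const_nhds h0 (fun n => zero_le) hb
  have h2 := (ENNReal.continuous_rpow_const (y := 1 / 2)).tendsto 0 |>.comp h1
  simp only [Function.comp_def] at h2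
  convert h2 using 2 with n
  · rw [← ENNReal.rpow_natCast, ← ENNReal.rpow_mul]; simp
  · simp

theorem cover [StandardBorelSpace X] [StandardBorelSpace Y] {ι : Type*} [Countable ι]
    {T : Lp ℂ 2 μ →L[ℂ] Lp ℂ 2 ν} {α : ι → Set X} {β : ι → Set Y}
    (hα : ∀ i, MeasurableSet (α i)) (hβ : ∀ i, MeasurableSet (β i)) (hk : ∀ i, Kills T (α i) (β i))
    {A M : Set X} {B N : Set Y} (hA : MeasurableSet A) (hB : MeasurableSet B)
    (hM : MeasurableSet M) (hN : MeasurableSet N) (hM0 : μ M = 0) (hN0 : ν N = 0)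
    (h : ∀ x ∈ A, ∀ y ∈ B, x ∉ M → y ∉ N → ∃ i, x ∈ α i ∧ y ∈ β i) : Kills T A B := by
  intro f g hf hg
  obtain ⟨t, _, _, hto⟩ := top_open hα
  obtain ⟨t', _, _, hto'⟩ := top_open hβ
  obtain ⟨K, hK1, hK2, hK3, hK4⟩ := compact_approx (hA.diff hM) f (by
    filter_upwards [hf, measure_eq_zero_iff_ae_notMem.1 hM0] with x h1 h2 h3
    exact h1 fun h4 => h3 ⟨h4, h2⟩)
  obtain ⟨L, hL1, hL2, hL3, hL4⟩ := compact_approx (hB.diff hN) g (by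
    filter_upwards [hg, measure_eq_zero_iff_ae_notMem.1 hN0] with x h1 h2 h3
    exact h1 fun h4 => h3 ⟨h4, h2⟩)
  have hz : ∀ n, ⟪T (mE (K n) (hK3 n) f), mE (L n) (hL3 n) g⟫ = (0 : ℂ) := by
    intro n
    obtain ⟨s, hs⟩ := ((hK2 n).prod (hL2 n)).elim_finite_subcover (fun i => α i ×ˢ β i)
      (fun i => (hto i).prod (hto' i)) (by
        rintro ⟨x, y⟩ ⟨hx, hy⟩
        obtain ⟨i, h1, h2⟩ := h x (hK1 n hx).1 y (hL1 n hy).1 (hK1 n hx).2 (hL1 n hy).2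
        exact mem_iUnion.2 ⟨i, h1, h2⟩)
    exact cover_fin hα hβ hk s _ _ hs _ _ (mE_vanish _ _ _) (mE_vanish _ _ _)
  have hl : Tendsto (fun n => ⟪T (mE (K n) (hK3 n) f), mE (L n) (hL3 n) g⟫) atTop (𝓝 ⟪T f, g⟫) :=
    ((T.continuous.tendsto f).comp hK4).inner hL4
  simp only [hz] at hl
  exact (tendsto_nhds_unique tendsto_const_nhds hl).symm

end Fsec
end OpSynth


set_option linter.unusedSectionVars false
namespace OpSynth
open Filter Topology

noncomputable section Gsec
variable {X Y : Type*} [MeasurableSpace X] [MeasurableSpace Y] {μ : Measure X} {ν : Measure Y} [SigmaFinite μ] [SigmaFinite ν]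

theorem hs4 {E : Type*} [NormedAddCommGroup E] {c : Unit ⊕ ℕ ⊕ ℕ ⊕ ℕ → E} {a b d e : E}
    (h0 : c (Sum.inl ()) = a) (h1 : HasSum (fun n => c (Sum.inr (Sum.inl n))) b)
    (h2 : HasSum (fun n => c (Sum.inr (Sum.inr (Sum.inl n)))) d)
    (h3 : HasSum (fun n => c (Sum.inr (Sum.inr (Sum.inr n)))) e) : HasSum c (a + (b + (d + e))) := by
  have hu : HasSum (c ∘ Sum.inl) a := by
    have := hasSum_unique (c ∘ Sum.inl : Unit → E)
    rw [← h0]; exact this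
  refine HasSum.sum hu (HasSum.sum h1 (HasSum.sum h2 h3))

theorem _root_.HasSum.congr_fn' {J E : Type*} [NormedAddCommGroup E] {f g : J → E} {a : E}
    (h : HasSum f a) (hfg : ∀ j, f j = g j) : HasSum g a := by
  rwa [← funext hfg]

theorem ae_summable {J : Type*} [Countable J] {ξ : J → Lp ℂ 2 μ} (h : Summable fun j => ‖ξ j‖ ^ 2) :
    ∀ᵐ p ∂μ, Summable fun j => ‖ξ j p‖ ^ 2 := by
  have h1 : ∫⁻ p, ∑' j, ‖ξ j p‖ₑ ^ 2 ∂μ ≠ ⊤ := by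
    rw [lintegral_tsum fun j => ((Lp.stronglyMeasurable (ξ j)).measurable.enorm.pow_const 2).aemeasurable]
    simp only [← enorm_sq]
    have : ∀ j, ‖ξ j‖ₑ ^ 2 = ENNReal.ofReal (‖ξ j‖ ^ 2) := fun j => by
      rw [ENNReal.ofReal_pow (norm_nonneg _), ofReal_norm]
    simp only [this]
    rw [← ENNReal.ofReal_tsum_of_nonneg (fun n => by positivity) h]
    exact ENNReal.ofReal_ne_top
  have hm : AEMeasurable (fun p => ∑' j, ‖ξ j p‖ₑ ^ 2) μ :=
    AEMeasurable.ennreal_tsum fun j =>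
      ((Lp.stronglyMeasurable (ξ j)).measurable.enorm.pow_const 2).aemeasurable
  filter_upwards [ae_lt_top' hm h1] with p hp
  have := ENNReal.summable_toReal hp.ne
  simpa using this

theorem null_of_ae {P : X → Prop} (h : ∀ᵐ p ∂μ, P p) :
    ∃ M, MeasurableSet M ∧ μ M = 0 ∧ ∀ p, p ∉ M → P p := by
  obtain ⟨M, h1, h2, h3⟩ := exists_measurable_superset_of_null (ae_iff.1 h)
  exact ⟨M, h2, h3, fun p hp => by_contra fun hn => hp (h1 hn)⟩

theorem step {M1 M2 : Submodule ℂ (Lp ℂ 2 μ →L[ℂ] Lp ℂ 2 ν)}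
    (hW1 : ∀ φ ψ, ∀ S ∈ wkClosure (M1 : Set (Lp ℂ 2 μ →L[ℂ] Lp ℂ 2 ν)),
      mulS ψ ∘L S ∘L mulS φ ∈ wkClosure (M1 : Set (Lp ℂ 2 μ →L[ℂ] Lp ℂ 2 ν)))
    (hW2 : ∀ φ ψ, ∀ S ∈ wkClosure (M2 : Set (Lp ℂ 2 μ →L[ℂ] Lp ℂ 2 ν)),
      mulS ψ ∘L S ∘L mulS φ ∈ wkClosure (M2 : Set (Lp ℂ 2 μ →L[ℂ] Lp ℂ 2 ν)))
    {T : Lp ℂ 2 μ →L[ℂ] Lp ℂ 2 ν}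
    (hT1 : ∀ F G, (∀ S ∈ wkClosure (M1 : Set (Lp ℂ 2 μ →L[ℂ] Lp ℂ 2 ν)), ⟪S F, G⟫ = 0) → ⟪T F, G⟫ = 0)
    (hT2 : ∀ F G, (∀ S ∈ wkClosure (M2 : Set (Lp ℂ 2 μ →L[ℂ] Lp ℂ 2 ν)), ⟪S F, G⟫ = 0) → ⟪T F, G⟫ = 0)
    {x : Lp ℂ 2 μ} {y : Lp ℂ 2 ν}
    (h : ∀ S ∈ wkClosure (M1 : Set (Lp ℂ 2 μ →L[ℂ] Lp ℂ 2 ν)) ∩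
      wkClosure (M2 : Set (Lp ℂ 2 μ →L[ℂ] Lp ℂ 2 ν)), ⟪y, S x⟫ = 0)
    {ε : ℝ} (hε : 0 < ε) :
    ∃ (ξ : ℕ → Lp ℂ 2 μ) (η : ℕ → Lp ℂ 2 ν), (Summable fun n => ‖ξ n‖ ^ 2) ∧
      (Summable fun n => ‖η n‖ ^ 2) ∧ ∑' n, ‖ξ n‖ ^ 2 ≤ ε ∧ ∑' n, ‖η n‖ ^ 2 ≤ ε ∧
      ∃ (ι : Type) (_ : Countable ι) (α : ι → Set X) (β : ι → Set Y), (∀ i, MeasurableSet (α i)) ∧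
        (∀ i, MeasurableSet (β i)) ∧ (∀ i, Kills T (α i) (β i)) ∧
        ∃ (M : Set X) (N : Set Y), MeasurableSet M ∧ MeasurableSet N ∧ μ M = 0 ∧ ν N = 0 ∧
          ∀ p q, p ∉ M → q ∉ N → (∀ i, ¬ (p ∈ α i ∧ q ∈ β i)) →
            ⟪y q, x p⟫ = ∑' n, ⟪η n q, ξ n p⟫ := by
  obtain ⟨p1, hp1, p2, hp2, ξ3, η3, s3, t3, b3, c3, e3⟩ := bipolar M1 M2 x y h hε
  obtain ⟨r1, ξ1, η1, s1, t1, -, -, e1⟩ := p1.2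
  obtain ⟨r2, ξ2, η2, s2, t2, -, -, e2⟩ := p2.2
  refine ⟨ξ3, η3, s3, t3, b3, c3, ?_⟩
  have z1 : ∀ S ∈ wkClosure (M1 : Set (Lp ℂ 2 μ →L[ℂ] Lp ℂ 2 ν)), ∑' n, ⟪η1 n, S (ξ1 n)⟫ = 0 := by
    intro S hS
    rw [← e1]
    exact (mem_wkClosure_iff M1 S).1 hS _ p1.2 hp1
  have z2 : ∀ S ∈ wkClosure (M2 : Set (Lp ℂ 2 μ →L[ℂ] Lp ℂ 2 ν)), ∑' n, ⟪η2 n, S (ξ2 n)⟫ = 0 := by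
    intro S hS
    rw [← e2]
    exact (mem_wkClosure_iff M2 S).1 hS _ p2.2 hp2
  let Ξ : Unit ⊕ ℕ ⊕ ℕ ⊕ ℕ → Lp ℂ 2 μ := Sum.elim (fun _ => x) (Sum.elim ξ1 (Sum.elim ξ2 ξ3))
  let Η : Unit ⊕ ℕ ⊕ ℕ ⊕ ℕ → Lp ℂ 2 ν := Sum.elim (fun _ => y) (Sum.elim (fun n => - η1 n)
    (Sum.elim (fun n => - η2 n) (fun n => - η3 n)))
  have z3 : ∀ S ∈ (univ : Set (Lp ℂ 2 μ →L[ℂ] Lp ℂ 2 ν)), ∑' j, ⟪Η j, S (Ξ j)⟫ = 0 := by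
    intro S _
    have := hs4 (c := fun j => ⟪Η j, S (Ξ j)⟫) (a := ⟪y, S x⟫) rfl
      (b := - p1.1 S) (d := - p2.1 S) (e := - (⟪y, S x⟫ - p1.1 S - p2.1 S))
      (by
        show HasSum (fun n => ⟪-η1 n, S (ξ1 n)⟫) _
        simp only [inner_neg_left]
        rw [e1]; exact (cs_summable s1 t1 S).hasSum.neg)
      (by
        show HasSum (fun n => ⟪-η2 n, S (ξ2 n)⟫) _
        simp only [inner_neg_left]
        rw [e2]; exact (cs_summable s2 t2 S).hasSum.neg)
      (by
        show HasSum (fun n => ⟪-η3 n, S (ξ3 n)⟫) _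
        simp only [inner_neg_left]
        have := e3 S
        dsimp only at this
        rw [this]; exact (cs_summable s3 t3 S).hasSum.neg)
    rw [this.tsum_eq]; ring
  obtain ⟨α1, β1, ha1, hb1, k1, c1⟩ := lemK hW1 z1
  obtain ⟨α2, β2, ha2, hb2, k2, c2⟩ := lemK hW2 z2
  obtain ⟨α3, β3, ha3, hb3, k3, c3⟩ := lemK (fun _ _ _ _ => mem_univ _) z3
  have aeM : ∀ᵐ p ∂μ, (Summable fun n => ‖ξ1 n p‖ ^ 2) ∧ (Summable fun n => ‖ξ2 n p‖ ^ 2) ∧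
      (Summable fun n => ‖ξ3 n p‖ ^ 2) := by
    filter_upwards [ae_summable s1, ae_summable s2, ae_summable s3] with p h1 h2 h3 using ⟨h1, h2, h3⟩
  have aeN : ∀ᵐ q ∂ν, ((Summable fun n => ‖η1 n q‖ ^ 2) ∧ (Summable fun n => ‖η2 n q‖ ^ 2) ∧
      (Summable fun n => ‖η3 n q‖ ^ 2)) ∧ (∀ n, (-η1 n : Lp ℂ 2 ν) q = -(η1 n q)) ∧
      (∀ n, (-η2 n : Lp ℂ 2 ν) q = -(η2 n q)) ∧ (∀ n, (-η3 n : Lp ℂ 2 ν) q = -(η3 n q)) := by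
    filter_upwards [ae_summable t1, ae_summable t2, ae_summable t3,
      ae_all_iff.2 fun n => Lp.coeFn_neg (η1 n), ae_all_iff.2 fun n => Lp.coeFn_neg (η2 n),
      ae_all_iff.2 fun n => Lp.coeFn_neg (η3 n)] with q h1 h2 h3 h4 h5 h6
    exact ⟨⟨h1, h2, h3⟩, h4, h5, h6⟩
  obtain ⟨M, hM, hM0, hMp⟩ := null_of_ae aeM
  obtain ⟨N, hN, hN0, hNq⟩ := null_of_ae aeN
  refine ⟨(ℕ × ℕ × ℕ) ⊕ (ℕ × ℕ × ℕ) ⊕ (ℕ × ℕ × ℕ), inferInstance, Sum.elim α1 (Sum.elim α2 α3),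
    Sum.elim β1 (Sum.elim β2 β3), ?_, ?_, ?_, M, N, hM, hN, hM0, hN0, ?_⟩
  · rintro (i | i | i)
    exacts [ha1 i, ha2 i, ha3 i]
  · rintro (i | i | i)
    exacts [hb1 i, hb2 i, hb3 i]
  · rintro (i | i | i)
    · exact fun f g hf hg => hT1 f g fun S hS => k1 i S hS f g hf hg
    · exact fun f g hf hg => hT2 f g fun S hS => k2 i S hS f g hf hg
    · exact k3 i T (mem_univ _)
  · intro p q hp hq hno
    obtain ⟨sp1, sp2, sp3⟩ := hMp p hp
    obtain ⟨⟨sq1, sq2, sq3⟩, n1, n2, n3⟩ := hNq q hq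
    have w1 : ∑' n, ⟪η1 n q, ξ1 n p⟫ = 0 := by
      by_contra hne
      obtain ⟨i, hi⟩ := c1 p q sp1 sq1 hne
      exact hno (Sum.inl i) hi
    have w2 : ∑' n, ⟪η2 n q, ξ2 n p⟫ = 0 := by
      by_contra hne
      obtain ⟨i, hi⟩ := c2 p q sp2 sq2 hne
      exact hno (Sum.inr (Sum.inl i)) hi
    have sΞ : Summable fun j => ‖Ξ j p‖ ^ 2 :=
      (hs4 (c := fun j => ‖Ξ j p‖ ^ 2) rfl sp1.hasSum sp2.hasSum sp3.hasSum).summable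
    have sΗ : Summable fun j => ‖Η j q‖ ^ 2 :=
      (hs4 (c := fun j => ‖Η j q‖ ^ 2) rfl (sq1.hasSum.congr_fn' (fun n => by
          show _ = ‖(-η1 n : Lp ℂ 2 ν) q‖ ^ 2
          rw [n1, norm_neg]))
        (sq2.hasSum.congr_fn' (fun n => by
          show _ = ‖(-η2 n : Lp ℂ 2 ν) q‖ ^ 2
          rw [n2, norm_neg]))
        (sq3.hasSum.congr_fn' (fun n => by
          show _ = ‖(-η3 n : Lp ℂ 2 ν) q‖ ^ 2
          rw [n3, norm_neg]))).summable
    have w3 : ∑' j, ⟪Η j q, Ξ j p⟫ = 0 := by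
      by_contra hne
      obtain ⟨i, hi⟩ := c3 p q sΞ sΗ hne
      exact hno (Sum.inr (Sum.inr i)) hi
    have u1 := cs_summable sp1 sq1 (ContinuousLinearMap.id ℂ ℂ)
    have u2 := cs_summable sp2 sq2 (ContinuousLinearMap.id ℂ ℂ)
    have u3 := cs_summable sp3 sq3 (ContinuousLinearMap.id ℂ ℂ)
    have := hs4 (c := fun j => ⟪Η j q, Ξ j p⟫) rfl (u1.hasSum.neg.congr_fn' (fun n => by
          show _ = ⟪(-η1 n : Lp ℂ 2 ν) q, ξ1 n p⟫
          rw [n1, inner_neg_left]; rfl))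
        (u2.hasSum.neg.congr_fn' (fun n => by
          show _ = ⟪(-η2 n : Lp ℂ 2 ν) q, ξ2 n p⟫
          rw [n2, inner_neg_left]; rfl))
        (u3.hasSum.neg.congr_fn' (fun n => by
          show _ = ⟪(-η3 n : Lp ℂ 2 ν) q, ξ3 n p⟫
          rw [n3, inner_neg_left]; rfl))
    rw [this.tsum_eq] at w3
    have v1 : ∑' n, ⟪η1 n q, (ContinuousLinearMap.id ℂ ℂ) (ξ1 n p)⟫ = 0 := w1
    have v2 : ∑' n, ⟪η2 n q, (ContinuousLinearMap.id ℂ ℂ) (ξ2 n p)⟫ = 0 := w2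
    rw [v1, v2] at w3
    have w4 : ⟪y q, x p⟫ + (-0 + (-0 + -∑' n, ⟪η3 n q, ξ3 n p⟫)) = 0 := w3
    linear_combination w4

theorem tail_zero {ξ : ℕ → ℕ → Lp ℂ 2 μ} (h1 : ∀ k, Summable fun n => ‖ξ k n‖ ^ 2)
    (h2 : ∀ k, ∑' n, ‖ξ k n‖ ^ 2 ≤ (1 / 4) ^ k) :
    ∀ᵐ p ∂μ, (∀ k, Summable fun n => ‖ξ k n p‖ ^ 2) ∧
      Tendsto (fun k => ∑' n, ‖ξ k n p‖ ^ 2) atTop (𝓝 0) := by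
  have hs : Summable fun j : ℕ × ℕ => ‖ξ j.1 j.2‖ ^ 2 := by
    rw [summable_prod_of_nonneg (fun j => by positivity)]
    refine ⟨h1, ?_⟩
    exact Summable.of_nonneg_of_le (fun k => tsum_nonneg fun n => by positivity) h2
      (summable_geometric_of_lt_one (by norm_num) (by norm_num))
  filter_upwards [ae_summable hs] with p hp
  exact ⟨fun k => hp.prod_factor k, hp.prod.tendsto_atTop_zero⟩

theorem key [StandardBorelSpace X] [StandardBorelSpace Y]
    {M1 M2 : Submodule ℂ (Lp ℂ 2 μ →L[ℂ] Lp ℂ 2 ν)}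
    (hW1 : ∀ φ ψ, ∀ S ∈ wkClosure (M1 : Set (Lp ℂ 2 μ →L[ℂ] Lp ℂ 2 ν)),
      mulS ψ ∘L S ∘L mulS φ ∈ wkClosure (M1 : Set (Lp ℂ 2 μ →L[ℂ] Lp ℂ 2 ν)))
    (hW2 : ∀ φ ψ, ∀ S ∈ wkClosure (M2 : Set (Lp ℂ 2 μ →L[ℂ] Lp ℂ 2 ν)),
      mulS ψ ∘L S ∘L mulS φ ∈ wkClosure (M2 : Set (Lp ℂ 2 μ →L[ℂ] Lp ℂ 2 ν)))
    {T : Lp ℂ 2 μ →L[ℂ] Lp ℂ 2 ν}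
    (hT1 : ∀ F G, (∀ S ∈ wkClosure (M1 : Set (Lp ℂ 2 μ →L[ℂ] Lp ℂ 2 ν)), ⟪S F, G⟫ = 0) → ⟪T F, G⟫ = 0)
    (hT2 : ∀ F G, (∀ S ∈ wkClosure (M2 : Set (Lp ℂ 2 μ →L[ℂ] Lp ℂ 2 ν)), ⟪S F, G⟫ = 0) → ⟪T F, G⟫ = 0)
    {x : Lp ℂ 2 μ} {y : Lp ℂ 2 ν}
    (h : ∀ S ∈ wkClosure (M1 : Set (Lp ℂ 2 μ →L[ℂ] Lp ℂ 2 ν)) ∩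
      wkClosure (M2 : Set (Lp ℂ 2 μ →L[ℂ] Lp ℂ 2 ν)), ⟪y, S x⟫ = 0) : ⟪T x, y⟫ = 0 := by
  have := fun k : ℕ => step hW1 hW2 hT1 hT2 h (ε := (1 / 4) ^ k) (by positivity)
  choose ξ η s t bs bt ι hι α β ha hb hk M N hM hN hM0 hN0 hpq using this
  obtain ⟨M', hM', hM0', hMp⟩ := null_of_ae (tail_zero s bs)
  obtain ⟨N', hN', hN0', hNq⟩ := null_of_ae (tail_zero t bt)
  have hA : MeasurableSet {p | x p ≠ 0} :=
    (Lp.stronglyMeasurable x).measurable (measurableSet_singleton 0).compl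
  have hB : MeasurableSet {q | y q ≠ 0} :=
    (Lp.stronglyMeasurable y).measurable (measurableSet_singleton 0).compl
  refine cover (ι := Σ k, ι k) (α := fun i => α i.1 i.2) (β := fun i => β i.1 i.2)
    (fun i => ha i.1 i.2) (fun i => hb i.1 i.2) (fun i => hk i.1 i.2) hA hB
    (M := M' ∪ ⋃ k, M k) (N := N' ∪ ⋃ k, N k) (hM'.union (MeasurableSet.iUnion hM))
    (hN'.union (MeasurableSet.iUnion hN))
    (measure_union_null hM0' (measure_iUnion_null hM0))
    (measure_union_null hN0' (measure_iUnion_null hN0)) ?_ x y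
    (Eventually.of_forall fun p hp => by simpa using hp)
    (Eventually.of_forall fun p hp => by simpa using hp)
  intro p hp q hq hpM hqN
  by_contra hno
  simp only [mem_union, mem_iUnion, not_or, not_exists] at hpM hqN
  have heq : ∀ k, ⟪y q, x p⟫ = ∑' n, ⟪η k n q, ξ k n p⟫ := fun k =>
    hpq k p q (hpM.2 k) (hqN.2 k) fun i hi => hno ⟨⟨k, i⟩, hi⟩
  obtain ⟨m1, m2⟩ := hMp p hpM.1
  obtain ⟨n1, n2⟩ := hNq q hqN.1
  have hle : ∀ k, ‖⟪y q, x p⟫‖ ≤ √(∑' n, ‖ξ k n p‖ ^ 2) * √(∑' n, ‖η k n q‖ ^ 2) := by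
    intro k
    rw [heq k]
    have := (cs_op (m1 k) (n1 k) (ContinuousLinearMap.id ℂ ℂ)).2
    simpa using this
  have hlim : Tendsto (fun k => √(∑' n, ‖ξ k n p‖ ^ 2) * √(∑' n, ‖η k n q‖ ^ 2)) atTop (𝓝 0) := by
    have := ((Real.continuous_sqrt.tendsto 0).comp m2).mul ((Real.continuous_sqrt.tendsto 0).comp n2)
    simpa using this
  have h0 : ‖⟪y q, x p⟫‖ ≤ 0 := ge_of_tendsto' hlim hle
  have h1 : ⟪y q, x p⟫ = 0 := norm_le_zero_iff.1 h0
  rw [RCLike.inner_apply] at h1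
  rcases mul_eq_zero.1 h1 with h2 | h2
  · exact hp h2
  · exact hq (by simpa using h2)

end Gsec
end OpSynth


set_option linter.unusedSectionVars false
namespace OpSynth
open Filter Topology

noncomputable section Hsec
variable {X Y : Type*} [MeasurableSpace X] [MeasurableSpace Y] {μ : Measure X} {ν : Measure Y} [SigmaFinite μ] [SigmaFinite ν]

/-- presentation of the complement of `κ` by rectangles, up to a marginally null set -/
def Pr (μ : Measure X) (ν : Measure Y) (κ : Set (X × Y)) {ι : Type} (α : ι → Set X)
    (β : ι → Set Y) : Prop :=
  (∀ i, MeasurableSet (α i)) ∧ (∀ i, MeasurableSet (β i)) ∧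
    ∃ (M : Set X) (N : Set Y), MeasurableSet M ∧ MeasurableSet N ∧ μ M = 0 ∧ ν N = 0 ∧
      ∀ x ∉ M, ∀ y ∉ N, ((x, y) ∈ κ ↔ ∀ i, ¬ (x ∈ α i ∧ y ∈ β i))

theorem OmegaClosed.pr {κ : Set (X × Y)} (h : OmegaClosed μ ν κ) :
    ∃ (α : ℕ → Set X) (β : ℕ → Set Y), Pr μ ν κ α β := by
  obtain ⟨α, β, ha, hb, M, N, hM, hN, hM0, hN0, hs⟩ := h
  refine ⟨α, β, ha, hb, M, N, hM, hN, hM0, hN0, fun x hx y hy => ?_⟩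
  have : (x, y) ∉ (M ×ˢ (univ : Set Y)) ∪ ((univ : Set X) ×ˢ N) := by
    simp [hx, hy]
  have h2 := fun h => this (hs h)
  simp only [mem_union, Set.mem_sdiff, mem_compl_iff, mem_iUnion, mem_prod] at h2
  constructor
  · intro hk i hi
    exact h2 (Or.inr ⟨⟨i, hi⟩, not_not.2 hk⟩)
  · intro hi
    by_contra hk
    exact h2 (Or.inl ⟨hk, fun ⟨i, h3⟩ => hi i h3⟩)

theorem Pr.omega {κ : Set (X × Y)} {ι : Type} {α : ι → Set X} {β : ι → Set Y} (h : Pr μ ν κ α β)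
    (e : ℕ ≃ ι) : OmegaClosed μ ν κ := by
  obtain ⟨ha, hb, M, N, hM, hN, hM0, hN0, hs⟩ := h
  refine ⟨fun n => α (e n), fun n => β (e n), fun n => ha _, fun n => hb _, M, N, hM, hN, hM0, hN0, ?_⟩
  rintro ⟨x, y⟩ hxy
  by_contra hno
  have hx : x ∉ M := fun hx => hno (by simp [hx])
  have hy : y ∉ N := fun hy => hno (by simp [hy])
  have h2 := hs x hx y hy
  simp only [mem_union, Set.mem_sdiff, mem_compl_iff, mem_iUnion, mem_prod] at hxy
  have h3 : (∃ n, x ∈ α (e n) ∧ y ∈ β (e n)) ↔ ∃ i, x ∈ α i ∧ y ∈ β i := 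
    ⟨fun ⟨n, h⟩ => ⟨e n, h⟩, fun ⟨i, h⟩ => ⟨e.symm i, by simpa using h⟩⟩
  rw [h3, h2] at hxy
  push Not at hxy
  rcases hxy with ⟨⟨i, hi⟩, h4⟩ | ⟨⟨i, hi⟩, h4⟩
  · exact h4 i hi.1 hi.2
  · exact h4 i hi.1 hi.2

theorem Pr.mmax [StandardBorelSpace X] [StandardBorelSpace Y] {κ : Set (X × Y)} {ι : Type}
    [Countable ι] {α : ι → Set X} {β : ι → Set Y} (h : Pr μ ν κ α β) {T : Lp ℂ 2 μ →L[ℂ] Lp ℂ 2 ν} :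
    T ∈ Mmax μ ν κ ↔ ∀ i, Kills T (α i) (β i) := by
  obtain ⟨ha, hb, M, N, hM, hN, hM0, hN0, hs⟩ := h
  constructor
  · intro hT i
    refine hT _ _ (ha i) (hb i) ⟨M, N, hM, hN, hM0, hN0, ?_⟩
    rintro ⟨x, y⟩ ⟨hxy, hk⟩
    by_contra hno
    have hx : x ∉ M := fun hx => hno (by simp [hx])
    have hy : y ∉ N := fun hy => hno (by simp [hy])
    exact (hs x hx y hy).1 hk i hxy
  · intro hT A B hA hB hAB
    obtain ⟨M', N', hM', hN', hM0', hN0', hs'⟩ := hAB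
    refine cover ha hb hT hA hB (hM.union hM') (hN.union hN') (measure_union_null hM0 hM0')
      (measure_union_null hN0 hN0') ?_
    intro x hx y hy hxM hyN
    simp only [mem_union, not_or] at hxM hyN
    by_contra hno
    push Not at hno
    have hk : (x, y) ∈ κ := (hs x hxM.1 y hyN.1).2 fun i hi => hno i hi.1 hi.2
    have := hs' ⟨mk_mem_prod hx hy, hk⟩
    simp [hxM.2, hyN.2] at this

theorem ref_mmax {κ : Set (X × Y)} : RefHull (Mmax μ ν κ) ⊆ Mmax μ ν κ := by
  intro T hT A B hA hB hAB f g hf hg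
  have hc : IsClosed {u : Lp ℂ 2 ν | ⟪u, g⟫ = (0 : ℂ)} := isClosed_eq (by fun_prop) continuous_const
  refine closure_minimal (t := {u : Lp ℂ 2 ν | ⟪u, g⟫ = (0 : ℂ)}) ?_ hc (hT f)
  rintro _ ⟨S, hS, rfl⟩
  exact hS A B hA hB hAB f g hf hg

theorem subset_ref {H K : Type*} [NormedAddCommGroup H] [InnerProductSpace ℂ H]
    [NormedAddCommGroup K] [InnerProductSpace ℂ K] (W : Set (H →L[ℂ] K)) : W ⊆ RefHull W :=
  fun T hT _ => subset_closure ⟨T, hT, rfl⟩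

theorem ref_mono {H K : Type*} [NormedAddCommGroup H] [InnerProductSpace ℂ H]
    [NormedAddCommGroup K] [InnerProductSpace ℂ K] {W W' : Set (H →L[ℂ] K)} (h : W ⊆ W') :
    RefHull W ⊆ RefHull W' :=
  fun _ hT x => closure_mono (image_mono h) (hT x)

section Tens
variable {H₁ H₂ K₁ K₂ T₁ T₂ : Type*}
  [NormedAddCommGroup H₁] [InnerProductSpace ℂ H₁] [NormedAddCommGroup H₂] [InnerProductSpace ℂ H₂]
  [NormedAddCommGroup K₁] [InnerProductSpace ℂ K₁] [NormedAddCommGroup K₂] [InnerProductSpace ℂ K₂]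
  [NormedAddCommGroup T₁] [InnerProductSpace ℂ T₁] [NormedAddCommGroup T₂] [InnerProductSpace ℂ T₂]

theorem wTensor_mono (t₁ : H₁ → K₁ → T₁) (t₂ : H₂ → K₂ → T₂) {V V' : Set (H₁ →L[ℂ] H₂)}
    {U U' : Set (K₁ →L[ℂ] K₂)} (hV : V ⊆ V') (hU : U ⊆ U') :
    wTensor t₁ t₂ V U ⊆ wTensor t₁ t₂ V' U' := by
  intro T hT
  rw [wTensor, mem_wkClosure_iff] at hT ⊢
  intro φ hφ h
  refine hT φ hφ fun S hS => h S ?_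
  refine Submodule.span_mono ?_ hS
  rintro W ⟨S, hS, R, hR, h⟩
  exact ⟨S, hV hS, R, hU hR, h⟩

theorem wTensor_swap (t₁ : H₁ → K₁ → T₁) (t₂ : H₂ → K₂ → T₂) (V : Set (H₁ →L[ℂ] H₂))
    (U : Set (K₁ →L[ℂ] K₂)) :
    wTensor (fun y x => t₁ x y) (fun y x => t₂ x y) U V = wTensor t₁ t₂ V U := by
  unfold wTensor
  congr 3
  ext W
  constructor
  · rintro ⟨S, hS, R, hR, h⟩
    exact ⟨R, hR, S, hS, fun x y => h y x⟩
  · rintro ⟨S, hS, R, hR, h⟩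
    exact ⟨R, hR, S, hS, fun x y => h y x⟩
end Tens

variable {X₁ X₂ Y₁ Y₂ : Type} [MeasurableSpace X₁] [MeasurableSpace X₂]
  [MeasurableSpace Y₁] [MeasurableSpace Y₂]
  {μ₁ : Measure X₁} {μ₂ : Measure X₂} {ν₁ : Measure Y₁} {ν₂ : Measure Y₂}
  [SigmaFinite μ₁] [SigmaFinite μ₂] [SigmaFinite ν₁] [SigmaFinite ν₂]

theorem mem_flip {κ : Set (X₁ × X₂)} {lam : Set (Y₁ × Y₂)} {p : X₁ × Y₁} {q : X₂ × Y₂} :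
    (p, q) ∈ flipProd '' (κ ×ˢ lam) ↔ (p.1, q.1) ∈ κ ∧ (p.2, q.2) ∈ lam := by
  constructor
  · rintro ⟨⟨⟨a, b⟩, ⟨c, d⟩⟩, ⟨h1, h2⟩, h⟩
    simp only [flipProd, Prod.mk.injEq] at h
    obtain ⟨rfl, rfl⟩ := h
    exact ⟨h1, h2⟩
  · rintro ⟨h1, h2⟩
    exact ⟨((p.1, q.1), (p.2, q.2)), ⟨h1, h2⟩, rfl⟩

theorem Pr.flip {κ : Set (X₁ × X₂)} {lam : Set (Y₁ × Y₂)} {α : ℕ → Set X₁} {β : ℕ → Set X₂}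
    {γ : ℕ → Set Y₁} {δ : ℕ → Set Y₂} (h : Pr μ₁ μ₂ κ α β) (h' : Pr ν₁ ν₂ lam γ δ) :
    Pr (μ₁.prod ν₁) (μ₂.prod ν₂) (flipProd '' (κ ×ˢ lam))
      (Sum.elim (fun n => α n ×ˢ univ) (fun n => univ ×ˢ γ n))
      (Sum.elim (fun n => β n ×ˢ univ) (fun n => univ ×ˢ δ n)) := by
  obtain ⟨ha, hb, M, N, hM, hN, hM0, hN0, hs⟩ := h
  obtain ⟨hc, hd, M', N', hM', hN', hM0', hN0', hs'⟩ := h'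
  refine ⟨?_, ?_, M ×ˢ univ ∪ univ ×ˢ M', N ×ˢ univ ∪ univ ×ˢ N', ?_, ?_, ?_, ?_, ?_⟩
  · rintro (i | i)
    exacts [(ha i).prod MeasurableSet.univ, MeasurableSet.univ.prod (hc i)]
  · rintro (i | i)
    exacts [(hb i).prod MeasurableSet.univ, MeasurableSet.univ.prod (hd i)]
  · exact (hM.prod MeasurableSet.univ).union (MeasurableSet.univ.prod hM')
  · exact (hN.prod MeasurableSet.univ).union (MeasurableSet.univ.prod hN')
  · refine measure_union_null ?_ ?_ <;> simp [Measure.prod_prod, hM0, hM0']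
  · refine measure_union_null ?_ ?_ <;> simp [Measure.prod_prod, hN0, hN0']
  · rintro ⟨x, y⟩ hp ⟨x', y'⟩ hq
    simp only [mem_union, mem_prod, mem_univ, and_true, true_and, not_or] at hp hq
    rw [mem_flip, hs x hp.1 x' hq.1, hs' y hp.2 y' hq.2]
    simp

theorem slice_mem {t₁ : Lp ℂ 2 μ₁ → Lp ℂ 2 ν₁ → Lp ℂ 2 (μ₁.prod ν₁)}
    {t₂ : Lp ℂ 2 μ₂ → Lp ℂ 2 ν₂ → Lp ℂ 2 (μ₂.prod ν₂)}
    (ht₁ : IsTensorEmbedding t₁) (ht₂ : IsTensorEmbedding t₂)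
    (ht₁' : ∀ f g, ⇑(t₁ f g) =ᵐ[μ₁.prod ν₁] fun p : X₁ × Y₁ => f p.1 * g p.2)
    (ht₂' : ∀ f g, ⇑(t₂ f g) =ᵐ[μ₂.prod ν₂] fun p : X₂ × Y₂ => f p.1 * g p.2)
    {κ : Set (X₁ × X₂)} {lam : Set (Y₁ × Y₂)}
    {T : Lp ℂ 2 (μ₁.prod ν₁) →L[ℂ] Lp ℂ 2 (μ₂.prod ν₂)}
    (hT : T ∈ Mmax (μ₁.prod ν₁) (μ₂.prod ν₂) (flipProd '' (κ ×ˢ lam))) (a b) :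
    slice ht₁ ht₂ T a b ∈ Mmax μ₁ μ₂ κ := by
  intro A B hA hB ⟨M, N, hM, hN, hM0, hN0, hs⟩ f g hf hg
  rw [slice, ContinuousLinearMap.comp_apply, ContinuousLinearMap.adjoint_inner_left]
  refine hT (A ×ˢ univ) (B ×ˢ univ) (hA.prod MeasurableSet.univ) (hB.prod MeasurableSet.univ)
    ⟨M ×ˢ univ, N ×ˢ univ, hM.prod MeasurableSet.univ, hN.prod MeasurableSet.univ,
      by simp [Measure.prod_prod, hM0], by simp [Measure.prod_prod, hN0], ?_⟩ _ _ ?_ ?_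
  · rintro ⟨p, q⟩ ⟨h1, h2⟩
    rw [mem_flip] at h2
    have := hs (a := (p.1, q.1)) ⟨⟨h1.1.1, h1.2.1⟩, h2.1⟩
    simpa using this
  · filter_upwards [ht₁' f a, Measure.quasiMeasurePreserving_fst.ae hf] with p h1 h2 h3
    show (t₁ f a) p = 0
    rw [h1]
    simp only [h2 fun h => h3 ⟨h, mem_univ _⟩, zero_mul]
  · filter_upwards [ht₂' g b, Measure.quasiMeasurePreserving_fst.ae hg] with p h1 h2 h3
    rw [Jop_apply, h1]
    simp only [h2 fun h => h3 ⟨h, mem_univ _⟩, zero_mul]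

theorem slice_mem' {t₁ : Lp ℂ 2 μ₁ → Lp ℂ 2 ν₁ → Lp ℂ 2 (μ₁.prod ν₁)}
    {t₂ : Lp ℂ 2 μ₂ → Lp ℂ 2 ν₂ → Lp ℂ 2 (μ₂.prod ν₂)}
    (ht₁ : IsTensorEmbedding t₁) (ht₂ : IsTensorEmbedding t₂)
    (ht₁' : ∀ f g, ⇑(t₁ f g) =ᵐ[μ₁.prod ν₁] fun p : X₁ × Y₁ => f p.1 * g p.2)
    (ht₂' : ∀ f g, ⇑(t₂ f g) =ᵐ[μ₂.prod ν₂] fun p : X₂ × Y₂ => f p.1 * g p.2)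
    {κ : Set (X₁ × X₂)} {lam : Set (Y₁ × Y₂)}
    {T : Lp ℂ 2 (μ₁.prod ν₁) →L[ℂ] Lp ℂ 2 (μ₂.prod ν₂)}
    (hT : T ∈ Mmax (μ₁.prod ν₁) (μ₂.prod ν₂) (flipProd '' (κ ×ˢ lam))) (a b) :
    slice ht₁.swap ht₂.swap T a b ∈ Mmax ν₁ ν₂ lam := by
  intro A B hA hB ⟨M, N, hM, hN, hM0, hN0, hs⟩ f g hf hg
  rw [slice, ContinuousLinearMap.comp_apply, ContinuousLinearMap.adjoint_inner_left]
  refine hT (univ ×ˢ A) (univ ×ˢ B) (MeasurableSet.univ.prod hA) (MeasurableSet.univ.prod hB)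
    ⟨univ ×ˢ M, univ ×ˢ N, MeasurableSet.univ.prod hM, MeasurableSet.univ.prod hN,
      by simp [Measure.prod_prod, hM0], by simp [Measure.prod_prod, hN0], ?_⟩ _ _ ?_ ?_
  · rintro ⟨p, q⟩ ⟨h1, h2⟩
    rw [mem_flip] at h2
    have := hs (a := (p.2, q.2)) ⟨⟨h1.1.2, h1.2.2⟩, h2.2⟩
    simpa using this
  · filter_upwards [ht₁' a f, Measure.quasiMeasurePreserving_snd.ae hf] with p h1 h2 h3
    show (t₁ a f) p = 0
    rw [h1]
    simp only [h2 fun h => h3 ⟨mem_univ _, h⟩, mul_zero]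
  · filter_upwards [ht₂' b g, Measure.quasiMeasurePreserving_snd.ae hg] with p h1 h2 h3
    rw [Jop_apply, h1]
    simp only [h2 fun h => h3 ⟨mem_univ _, h⟩, mul_zero]

end Hsec
end OpSynth

/-- Proposition 5.3, formulas (5.4) and (5.5). -/
theorem statement12
    (X₁ X₂ Y₁ Y₂ : Type)
    [MeasurableSpace X₁] [StandardBorelSpace X₁]
    [MeasurableSpace X₂] [StandardBorelSpace X₂]
    [MeasurableSpace Y₁] [StandardBorelSpace Y₁]
    [MeasurableSpace Y₂] [StandardBorelSpace Y₂]
    (μ₁ : Measure X₁) (μ₂ : Measure X₂) (ν₁ : Measure Y₁) (ν₂ : Measure Y₂)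
    [SigmaFinite μ₁] [SigmaFinite μ₂] [SigmaFinite ν₁] [SigmaFinite ν₂]
    (U : Set (Lp ℂ 2 μ₁ →L[ℂ] Lp ℂ 2 μ₂)) (V : Set (Lp ℂ 2 ν₁ →L[ℂ] Lp ℂ 2 ν₂))
    (hU : IsMultBimodule μ₁ μ₂ U) (hV : IsMultBimodule ν₁ ν₂ V)
    (κ : Set (X₁ × X₂)) (lam : Set (Y₁ × Y₂))
    (hκ : HasSupport μ₁ μ₂ U κ) (hlam : HasSupport ν₁ ν₂ V lam)
    -- the canonical identifications L²(X₁)⊗L²(Y₁) ≅ L²(X₁×Y₁), etc.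
    (t₁ : Lp ℂ 2 μ₁ → Lp ℂ 2 ν₁ → Lp ℂ 2 (μ₁.prod ν₁))
    (t₂ : Lp ℂ 2 μ₂ → Lp ℂ 2 ν₂ → Lp ℂ 2 (μ₂.prod ν₂))
    (ht₁ : IsTensorEmbedding t₁) (ht₂ : IsTensorEmbedding t₂)
    (ht₁' : ∀ f g, ⇑(t₁ f g) =ᵐ[μ₁.prod ν₁] fun p : X₁ × Y₁ => f p.1 * g p.2)
    (ht₂' : ∀ f g, ⇑(t₂ f g) =ᵐ[μ₂.prod ν₂] fun p : X₂ × Y₂ => f p.1 * g p.2) :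
    HasSupport (μ₁.prod ν₁) (μ₂.prod ν₂) (Fubini t₁ t₂ U V)
        (flipProd '' (κ ×ˢ lam)) ∧
    Fubini t₁ t₂ (Mmax μ₁ μ₂ κ) (Mmax ν₁ ν₂ lam) =
      Mmax (μ₁.prod ν₁) (μ₂.prod ν₂) (flipProd '' (κ ×ˢ lam)) := by
  obtain ⟨α, β, hp⟩ := hκ.1.pr
  obtain ⟨γ, δ, hp'⟩ := hlam.1.pr
  have hpf := hp.flip hp'
  have hb : Fubini t₁ t₂ (Mmax μ₁ μ₂ κ) (Mmax ν₁ ν₂ lam) =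
      Mmax (μ₁.prod ν₁) (μ₂.prod ν₂) (flipProd '' (κ ×ˢ lam)) := by
    refine Subset.antisymm ?_ ?_
    · rintro T ⟨hT1, hT2⟩
      rw [hpf.mmax]
      rintro (n | n)
      · exact kills_left ht₁ ht₂ ht₁' ht₂' (hp.1 n) (hp.2.1 n) MeasurableSet.univ MeasurableSet.univ
          (Or.inl fun S hS => hp.mmax.1 hS n) hT1
      · exact kills_left ht₁ ht₂ ht₁' ht₂' MeasurableSet.univ MeasurableSet.univ (hp'.1 n) (hp'.2.1 n)
          (Or.inr fun S hS => hp'.mmax.1 hS n) hT2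
    · intro T hT
      refine ⟨mem_wTensor_of_slices ht₁ ht₂ _ T fun a b => slice_mem ht₁ ht₂ ht₁' ht₂' hT a b, ?_⟩
      rw [← wTensor_swap]
      exact mem_wTensor_of_slices ht₁.swap ht₂.swap _ T
        fun a b => slice_mem' ht₁ ht₂ ht₁' ht₂' hT a b
  refine ⟨⟨hpf.omega Equiv.natSumNatEquivNat.symm, Subset.antisymm ?_ ?_⟩, hb⟩
  · refine (ref_mono ?_).trans ref_mmax
    rw [← hb]
    exact inter_subset_inter (wTensor_mono _ _ (hκ.2 ▸ subset_ref U) le_rfl)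
      (wTensor_mono _ _ le_rfl (hlam.2 ▸ subset_ref V))
  · intro T hT x
    have hUm : ∀ S ∈ U, ∀ α β (hα : MeasurableSet α) (hβ : MeasurableSet β),
        mE β hβ ∘L S ∘L mE α hα ∈ U := fun S hS _ _ _ _ =>
      hU.2 S hS _ _ (mulS_isMult _) (mulS_isMult _)
    have hVm : ∀ S ∈ V, ∀ α β (hα : MeasurableSet α) (hβ : MeasurableSet β),
        mE β hβ ∘L S ∘L mE α hα ∈ V := fun S hS _ _ _ _ =>
      hV.2 S hS _ _ (mulS_isMult _) (mulS_isMult _)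
    set M1 := Submodule.span ℂ { W : Lp ℂ 2 (μ₁.prod ν₁) →L[ℂ] Lp ℂ 2 (μ₂.prod ν₂) |
      ∃ S ∈ U, ∃ R ∈ (univ : Set (Lp ℂ 2 ν₁ →L[ℂ] Lp ℂ 2 ν₂)), IsElemTensor t₁ t₂ W S R }
    set M2 := Submodule.span ℂ { W : Lp ℂ 2 (μ₁.prod ν₁) →L[ℂ] Lp ℂ 2 (μ₂.prod ν₂) |
      ∃ S ∈ (univ : Set (Lp ℂ 2 μ₁ →L[ℂ] Lp ℂ 2 μ₂)), ∃ R ∈ V, IsElemTensor t₁ t₂ W S R }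
    let E : (Lp ℂ 2 (μ₁.prod ν₁) →L[ℂ] Lp ℂ 2 (μ₂.prod ν₂)) →ₗ[ℂ] Lp ℂ 2 (μ₂.prod ν₂) :=
      { toFun := fun S => S x
        map_add' := fun _ _ => rfl
        map_smul' := fun _ _ => rfl }
    have hmap : ((wSub M1 ⊓ wSub M2).map E : Set (Lp ℂ 2 (μ₂.prod ν₂))) =
        (fun S : Lp ℂ 2 (μ₁.prod ν₁) →L[ℂ] Lp ℂ 2 (μ₂.prod ν₂) => S x) '' Fubini t₁ t₂ U V := rfl
    rw [← hmap, ← Submodule.topologicalClosure_coe, ← Submodule.orthogonal_orthogonal_eq_closure]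
    show T x ∈ ((wSub M1 ⊓ wSub M2).map E)ᗮᗮ
    rw [Submodule.mem_orthogonal]
    intro y hy
    rw [Submodule.mem_orthogonal] at hy
    have := key (M1 := M1) (M2 := M2) (T := T) (x := x) (y := y)
      (fun φ ψ S hS => wT_mul ht₁' ht₂' hUm (fun _ _ _ _ _ _ => mem_univ _) φ ψ S hS)
      (fun φ ψ S hS => wT_mul ht₁' ht₂' (fun _ _ _ _ _ _ => mem_univ _) hVm φ ψ S hS)
      (fun F G h => inner_zero_of_slices ht₁ ht₂ U T
        (fun a b => hκ.2 ▸ slice_mem ht₁ ht₂ ht₁' ht₂' hT a b) F G h)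
      (fun F G h => inner_zero_of_slices ht₁.swap ht₂.swap V T
        (fun a b => hlam.2 ▸ slice_mem' ht₁ ht₂ ht₁' ht₂' hT a b) F G (by
          rw [wTensor_swap]; exact h))
      (fun S hS => by
        rw [← inner_conj_symm, hy (S x) ⟨S, hS, rfl⟩, map_zero])
    rw [← inner_conj_symm, this, map_zero]
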